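/- arXiv:1310.8130 — 6 statements merged into one kernel-verified Lean document; each statement's English description precedes it below -/
import Mathlib

section
/- The pushforward of the Cauchy measure ν_n under the gnomonic projection q is the normalized Riemannian volume of the open hemisphere: for every Borel set A ⊆ S^n, ν_n(q^{-1}(A)) = μ_n(A ∩ S^n_+) / μ_n(S^n_+). Equivalently, q_*(ν_n) equals the restriction of μ_n to S^n_+ divided by μ_n(S^n_+). -/
open MeasureTheory Real
open scoped RealInnerProductSpace ENNReal

/-- Density (up to constant) of the Cauchy measure on `ℝⁿ`. -/
noncomputable def cauchyDensity (n : ℕ) (x : EuclideanSpace ℝ (Fin n)) : ℝ :=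
  (1 + ‖x‖ ^ 2) ^ (-(((n : ℝ) + 1) / 2))

/-- Normalizing constant of the Cauchy measure. -/
noncomputable def cauchyConst (n : ℕ) : ℝ :=
  (∫ x : EuclideanSpace ℝ (Fin n), cauchyDensity n x)⁻¹

/-- The Cauchy measure `ν_n` on `ℝⁿ`. -/
noncomputable def cauchyMeasure (n : ℕ) : Measure (EuclideanSpace ℝ (Fin n)) :=
  volume.withDensity fun x => ENNReal.ofReal (cauchyConst n * cauchyDensity n x)

/-- Gnomonic projection of `ℝⁿ` onto the open upper hemisphere of `Sⁿ ⊆ ℝ^{n+1}`. -/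
noncomputable def gnomonic (n : ℕ) (x : EuclideanSpace ℝ (Fin n)) :
    EuclideanSpace ℝ (Fin (n + 1)) :=
  (Real.sqrt (1 + ‖x‖ ^ 2))⁻¹ •
    ((EuclideanSpace.equiv (Fin (n + 1)) ℝ).symm (Fin.snoc (fun i => x i) 1))

/-- The pole `o = e_{n+1}`. -/
noncomputable def pole (n : ℕ) : EuclideanSpace ℝ (Fin (n + 1)) :=
  EuclideanSpace.single (Fin.last n) 1

/-- The unit sphere `Sⁿ ⊆ ℝ^{n+1}` as a set. -/
noncomputable def unitSphereSet (n : ℕ) : Set (EuclideanSpace ℝ (Fin (n + 1))) :=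
  Metric.sphere 0 1

/-- The open hemisphere `Sⁿ₊` centered at the pole. -/
noncomputable def hemisphere (n : ℕ) : Set (EuclideanSpace ℝ (Fin (n + 1))) :=
  {y ∈ unitSphereSet n | 0 < ⟪y, pole n⟫}

theorem measure_le_liminf_mul_of_measure_ball_eq {X : Type*} [MetricSpace X]
    [SecondCountableTopology X] [MeasurableSpace X] [BorelSpace X] {μ ν : Measure X}
    [IsFiniteMeasure μ] [IsFiniteMeasure ν] {S : Set X} (hμS : μ Sᶜ = 0) (hνS : ν Sᶜ = 0)
    {g h : ℝ → ℝ≥0∞} (hg : ∀ x ∈ S, ∀ r, μ (Metric.ball x r) = g r)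
    (hh : ∀ x ∈ S, ∀ r, ν (Metric.ball x r) = h r) {r : ℕ → ℝ}
    (hr0 : Filter.Tendsto r Filter.atTop (nhds 0)) (hpos : ∀ k, h (r k) ≠ 0)
    (hfin : ∀ k, h (r k) ≠ ∞) {U : Set X} (hU : IsOpen U) :
    μ U ≤ Filter.liminf (fun k => g (r k) / h (r k)) Filter.atTop * ν U := by
  have hμae : ∀ᵐ x ∂μ, x ∈ S := by rw [ae_iff]; exact hμS
  have hνae : ∀ᵐ x ∂ν, x ∈ S := by rw [ae_iff]; exact hνS
  have hmeas : ∀ k, MeasurableSet {p : X × X | dist p.2 p.1 < r k} := fun k =>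
    (isOpen_lt (by fun_prop) continuous_const).measurableSet
  have hslice : ∀ k, Measurable fun x => (ν.restrict U) (Metric.ball x (r k)) := fun k =>
    measurable_measure_prodMk_left (ν := ν.restrict U) (hmeas k)
  calc μ U = ∫⁻ _ in U, 1 ∂μ := by simp
    _ ≤ ∫⁻ x in U, Filter.liminf
          (fun k => (ν.restrict U) (Metric.ball x (r k)) / h (r k)) Filter.atTop ∂μ := by
        refine lintegral_mono_ae ?_
        filter_upwards [ae_restrict_of_ae hμae, ae_restrict_mem hU.measurableSet] with x hxS hxU
        obtain ⟨ε, hε, hsub⟩ := Metric.isOpen_iff.1 hU x hxU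
        refine Filter.le_liminf_of_le (by isBoundedDefault) ?_
        filter_upwards [hr0.eventually (gt_mem_nhds hε)] with k hk
        rw [Measure.restrict_apply measurableSet_ball,
          Set.inter_eq_left.2 ((Metric.ball_subset_ball hk.le).trans hsub), hh x hxS,
          ENNReal.div_self (hpos k) (hfin k)]
    _ ≤ Filter.liminf (fun k => ∫⁻ x in U,
          (ν.restrict U) (Metric.ball x (r k)) / h (r k) ∂μ) Filter.atTop :=
        lintegral_liminf_le fun k => (hslice k).div_const _
    _ ≤ Filter.liminf (fun k => ν U * (g (r k) / h (r k))) Filter.atTop := by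
        refine Filter.liminf_le_liminf (Filter.Eventually.of_forall fun k => ?_)
          (by isBoundedDefault) (by isBoundedDefault)
        simp_rw [div_eq_mul_inv]
        rw [lintegral_mul_const _ (hslice k), ← mul_assoc]
        gcongr
        calc ∫⁻ x in U, (ν.restrict U) (Metric.ball x (r k)) ∂μ
            = ((μ.restrict U).prod (ν.restrict U)) {p : X × X | dist p.2 p.1 < r k} := by
              rw [Measure.prod_apply (hmeas k)]; rfl
          _ = ∫⁻ y in U, (μ.restrict U) (Metric.ball y (r k)) ∂ν := by
              rw [Measure.prod_apply_symm (hmeas k)]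
              simp only [Metric.ball, Set.preimage_ofPred_eq, dist_comm]
          _ ≤ ∫⁻ _ in U, g (r k) ∂ν := by
              refine lintegral_mono_ae ?_
              filter_upwards [ae_restrict_of_ae hνae] with y hy
              rw [← hg y hy]
              exact Measure.restrict_apply_le _ _
          _ = ν U * g (r k) := by simp [mul_comm]
    _ = Filter.liminf (fun k => g (r k) / h (r k)) Filter.atTop * ν U := by
        rw [ENNReal.liminf_const_mul_of_ne_top (measure_ne_top ν U), mul_comm]

/-- Two finite measures which are uniformly distributed on the same set are proportional. -/
theorem exists_eq_smul_of_measure_ball_eq {X : Type*} [MetricSpace X]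
    [SecondCountableTopology X] [MeasurableSpace X] [BorelSpace X] {μ ν : Measure X}
    [IsFiniteMeasure μ] [IsFiniteMeasure ν] {S : Set X} (hμS : μ Sᶜ = 0) (hνS : ν Sᶜ = 0)
    {g h : ℝ → ℝ≥0∞} (hg : ∀ x ∈ S, ∀ r, μ (Metric.ball x r) = g r)
    (hh : ∀ x ∈ S, ∀ r, ν (Metric.ball x r) = h r) (hμ : μ ≠ 0) (hν : ν ≠ 0) :
    ∃ c : ℝ≥0∞, c ≠ 0 ∧ c ≠ ∞ ∧ μ = c • ν := by
  have key : ∀ {m : Measure X} [IsFiniteMeasure m] {f : ℝ → ℝ≥0∞}, m Sᶜ = 0 → m ≠ 0 →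
      (∀ x ∈ S, ∀ r, m (Metric.ball x r) = f r) → ∀ r, 0 < r → f r ≠ 0 ∧ f r ≠ ∞ := by
    intro m _ f hmS hm hf r hr
    have hmS' : m S ≠ 0 := fun h0 => hm <| by
      rw [← Measure.measure_univ_eq_zero, ← Set.union_compl_self S]
      exact measure_union_null h0 hmS
    refine ⟨fun h0 => hmS' ?_, ?_⟩
    · exact measure_null_of_locally_null S fun x hx =>
        ⟨_, mem_nhdsWithin_of_mem_nhds (Metric.ball_mem_nhds x hr), (hf x hx r).trans h0⟩
    · obtain ⟨x, hx⟩ := nonempty_of_measure_ne_zero hmS'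
      rw [← hf x hx]
      exact measure_ne_top _ _
  obtain ⟨r, -, hr, hr0⟩ := exists_seq_strictAnti_tendsto (0 : ℝ)
  have hgk := fun k => key hμS hμ hg (r k) (hr k)
  have hhk := fun k => key hνS hν hh (r k) (hr k)
  set c := Filter.liminf (fun k => g (r k) / h (r k)) Filter.atTop with hc
  set c' := Filter.liminf (fun k => h (r k) / g (r k)) Filter.atTop with hc'
  have hcc' : c * c' ≤ 1 := by
    have : c' = (Filter.limsup (fun k => g (r k) / h (r k)) Filter.atTop)⁻¹ := by
      rw [ENNReal.inv_limsup, hc']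
      congr 1
      ext k
      rw [ENNReal.inv_div (Or.inl (hhk k).2) (Or.inl (hhk k).1)]
    rw [this]
    exact (mul_le_mul_left (Filter.liminf_le_limsup (by isBoundedDefault)
      (by isBoundedDefault)) _).trans (ENNReal.mul_inv_le_one _)
  have hopen : ∀ U, IsOpen U → μ U = c * ν U := fun U hU => by
    refine le_antisymm (measure_le_liminf_mul_of_measure_ball_eq hμS hνS hg hh hr0
      (fun k => (hhk k).1) (fun k => (hhk k).2) hU) ?_
    calc c * ν U ≤ c * (c' * μ U) := by
          gcongr
          exact measure_le_liminf_mul_of_measure_ball_eq hνS hμS hh hg hr0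
            (fun k => (hgk k).1) (fun k => (hgk k).2) hU
      _ = (c * c') * μ U := (mul_assoc _ _ _).symm
      _ ≤ 1 * μ U := by gcongr
      _ = μ U := one_mul _
  have huniv := hopen Set.univ isOpen_univ
  refine ⟨c, ?_, ?_, ext_of_generate_finite _ BorelSpace.measurable_eq isPiSystem_isOpen
    (fun U hU => by simpa using hopen U hU) (by simpa using huniv)⟩
  · intro h0
    rw [h0, zero_mul, Measure.measure_univ_eq_zero] at huniv
    exact hμ huniv
  · intro htop
    rw [htop, ENNReal.top_mul (by simpa using hν)] at huniv
    exact measure_ne_top _ _ huniv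

theorem exists_linearIsometryEquiv_apply_eq {E : Type*} [NormedAddCommGroup E]
    [InnerProductSpace ℝ E] {x y : E} (h : ‖x‖ = ‖y‖) : ∃ L : E ≃ₗᵢ[ℝ] E, L x = y :=
  ⟨_, Submodule.reflection_sub h⟩

theorem measure_ball_eq_of_measurePreserving {E : Type*} [NormedAddCommGroup E]
    [InnerProductSpace ℝ E] [MeasurableSpace E] [BorelSpace E] {μ : Measure E}
    (hμ : ∀ L : E ≃ₗᵢ[ℝ] E, MeasurePreserving L μ μ) {x y : E} (h : ‖x‖ = ‖y‖) (r : ℝ) :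
    μ (Metric.ball x r) = μ (Metric.ball y r) := by
  obtain ⟨L, rfl⟩ := exists_linearIsometryEquiv_apply_eq h
  rw [← (hμ L).measure_preimage (s := Metric.ball (L x) r) measurableSet_ball.nullMeasurableSet,
    LinearIsometryEquiv.preimage_ball, LinearIsometryEquiv.symm_apply_apply]

theorem measurePreserving_restrict_sphere_hausdorffMeasure {E : Type*} [NormedAddCommGroup E]
    [InnerProductSpace ℝ E] [MeasurableSpace E] [BorelSpace E] (d : ℝ) (L : E ≃ₗᵢ[ℝ] E) :
    MeasurePreserving L ((μH[d] : Measure E).restrict (Metric.sphere 0 1))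
      ((μH[d] : Measure E).restrict (Metric.sphere 0 1)) := by
  have := (L.toIsometryEquiv.measurePreserving_hausdorffMeasure d).restrict_preimage
    (s := Metric.sphere (0 : E) 1) Metric.isClosed_sphere.measurableSet
  have h : L.toIsometryEquiv ⁻¹' Metric.sphere (0 : E) 1 = Metric.sphere 0 1 := by
    ext z; simp
  rwa [h] at this

/-- The measure on the unit sphere given by the volume of the cone over a set. -/
noncomputable def coneMeasure (E : Type*) [NormedAddCommGroup E] [InnerProductSpace ℝ E]
    [FiniteDimensional ℝ E] [MeasurableSpace E] [BorelSpace E] : Measure E :=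
  (volume.restrict (Metric.ball 0 1)).map fun z => ‖z‖⁻¹ • z

section coneMeasure

variable {E : Type*} [NormedAddCommGroup E] [InnerProductSpace ℝ E]
  [FiniteDimensional ℝ E] [MeasurableSpace E] [BorelSpace E]

theorem measurable_norm_inv_smul : Measurable fun z : E => ‖z‖⁻¹ • z := by
  fun_prop

theorem coneMeasure_apply {A : Set E} (hA : MeasurableSet A) :
    coneMeasure E A = volume {z : E | ‖z‖ < 1 ∧ ‖z‖⁻¹ • z ∈ A} := by
  rw [coneMeasure, Measure.map_apply measurable_norm_inv_smul hA,
    Measure.restrict_apply (measurable_norm_inv_smul hA)]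
  congr 1
  ext z
  simp [and_comm]

instance : IsFiniteMeasure (coneMeasure E) := by
  have : IsFiniteMeasure ((volume : Measure E).restrict (Metric.ball 0 1)) :=
    ⟨by simpa using measure_ball_lt_top⟩
  unfold coneMeasure
  infer_instance

theorem coneMeasure_ne_zero : coneMeasure E ≠ 0 := by
  rw [← Measure.measure_univ_ne_zero, coneMeasure_apply MeasurableSet.univ]
  convert (Metric.measure_ball_pos (volume : Measure E) 0 one_pos).ne' using 2
  ext z
  simp

theorem coneMeasure_compl_sphere [Nontrivial E] :
    coneMeasure E (Metric.sphere 0 1)ᶜ = 0 := by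
  rw [coneMeasure_apply Metric.isClosed_sphere.measurableSet.compl]
  refine measure_mono_null (t := {0}) (fun z hz => ?_) (measure_singleton 0)
  by_contra h0
  refine hz.2 ?_
  simp [norm_smul, inv_mul_cancel₀ (norm_ne_zero_iff.2 h0)]

theorem measurePreserving_coneMeasure (L : E ≃ₗᵢ[ℝ] E) :
    MeasurePreserving L (coneMeasure E) (coneMeasure E) := by
  refine ⟨L.continuous.measurable, ?_⟩
  ext A hA
  rw [Measure.map_apply L.continuous.measurable hA, coneMeasure_apply hA,
    coneMeasure_apply (L.continuous.measurable hA)]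
  have hm : MeasurableSet {z : E | ‖z‖ < 1 ∧ ‖z‖⁻¹ • z ∈ A} :=
    (measurableSet_lt measurable_norm measurable_const).inter (measurable_norm_inv_smul hA)
  rw [← L.measurePreserving.measure_preimage hm.nullMeasurableSet]
  congr 1
  ext z
  simp

end coneMeasure

section coordinates

variable {n : ℕ}

/-- The point `(w, t)` of `ℝⁿ × ℝ = ℝⁿ⁺¹`. -/
noncomputable def snocEuclidean (w : EuclideanSpace ℝ (Fin n)) (t : ℝ) :
    EuclideanSpace ℝ (Fin (n + 1)) :=
  WithLp.toLp 2 (Fin.snoc (fun i => w i) t)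

/-- The projection `ℝⁿ⁺¹ → ℝⁿ` forgetting the last coordinate. -/
noncomputable def initEuclidean (z : EuclideanSpace ℝ (Fin (n + 1))) :
    EuclideanSpace ℝ (Fin n) :=
  WithLp.toLp 2 fun i => z i.castSucc

@[simp]
theorem snocEuclidean_castSucc (w : EuclideanSpace ℝ (Fin n)) (t : ℝ) (i : Fin n) :
    snocEuclidean w t i.castSucc = w i := by
  simp [snocEuclidean]

@[simp]
theorem snocEuclidean_last (w : EuclideanSpace ℝ (Fin n)) (t : ℝ) :
    snocEuclidean w t (Fin.last n) = t := by
  simp [snocEuclidean]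

@[simp]
theorem initEuclidean_apply (z : EuclideanSpace ℝ (Fin (n + 1))) (i : Fin n) :
    initEuclidean z i = z i.castSucc := rfl

@[simp]
theorem snocEuclidean_initEuclidean (z : EuclideanSpace ℝ (Fin (n + 1))) :
    snocEuclidean (initEuclidean z) (z (Fin.last n)) = z := by
  ext i
  refine Fin.lastCases ?_ (fun i => ?_) i <;> simp

@[simp]
theorem initEuclidean_snocEuclidean (w : EuclideanSpace ℝ (Fin n)) (t : ℝ) :
    initEuclidean (snocEuclidean w t) = w := by
  ext i
  simp

theorem smul_snocEuclidean (c t : ℝ) (w : EuclideanSpace ℝ (Fin n)) :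
    c • snocEuclidean w t = snocEuclidean (c • w) (c * t) := by
  ext i
  refine Fin.lastCases ?_ (fun i => ?_) i <;> simp

theorem norm_snocEuclidean_sq (w : EuclideanSpace ℝ (Fin n)) (t : ℝ) :
    ‖snocEuclidean w t‖ ^ 2 = ‖w‖ ^ 2 + t ^ 2 := by
  simp [EuclideanSpace.real_norm_sq_eq, Fin.sum_univ_castSucc]

theorem norm_snocEuclidean_one (w : EuclideanSpace ℝ (Fin n)) :
    ‖snocEuclidean w 1‖ = √(1 + ‖w‖ ^ 2) := by
  rw [← Real.sqrt_sq (norm_nonneg _), norm_snocEuclidean_sq, one_pow, add_comm]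

theorem continuous_snocEuclidean :
    Continuous fun p : ℝ × EuclideanSpace ℝ (Fin n) => snocEuclidean p.2 p.1 := by
  refine (PiLp.continuous_toLp 2 _).comp (continuous_pi fun i => ?_)
  refine Fin.lastCases ?_ (fun i => ?_) i <;> simp <;> fun_prop

theorem contDiff_snocEuclidean_one :
    ContDiff ℝ 1 fun w : EuclideanSpace ℝ (Fin n) => snocEuclidean w 1 := by
  rw [contDiff_euclidean]
  intro i
  refine Fin.lastCases ?_ (fun i => ?_) i
  · simpa using contDiff_const
  · simp only [snocEuclidean_castSucc]
    fun_prop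

theorem lipschitzWith_initEuclidean :
    LipschitzWith 1 (initEuclidean : EuclideanSpace ℝ (Fin (n + 1)) → _) := by
  refine LipschitzWith.of_dist_le_mul fun x y => ?_
  rw [NNReal.coe_one, one_mul, EuclideanSpace.dist_eq, EuclideanSpace.dist_eq]
  refine Real.sqrt_le_sqrt ?_
  rw [Fin.sum_univ_castSucc]
  simp only [initEuclidean_apply]
  exact le_add_of_nonneg_right (sq_nonneg _)

theorem volume_eq_lintegral_snocEuclidean {S : Set (EuclideanSpace ℝ (Fin (n + 1)))}
    (hS : MeasurableSet S) :
    volume S = ∫⁻ t : ℝ, volume {w : EuclideanSpace ℝ (Fin n) | snocEuclidean w t ∈ S} := by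
  have hΦ := ((MeasurePreserving.id (volume : Measure ℝ)).prod
    (PiLp.volume_preserving_toLp (Fin n))).comp
      ((volume_preserving_piFinSuccAbove (fun _ : Fin (n + 1) => ℝ) (Fin.last n)).comp
        (PiLp.volume_preserving_ofLp (Fin (n + 1))))
  have hψ : MeasurableSet {p : ℝ × EuclideanSpace ℝ (Fin n) | snocEuclidean p.2 p.1 ∈ S} :=
    continuous_snocEuclidean.measurable hS
  have h := hΦ.measure_preimage hψ.nullMeasurableSet
  rw [Measure.prod_apply hψ] at h
  refine Eq.trans ?_ h
  congr 1
  ext z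
  have : snocEuclidean (WithLp.toLp 2 fun i : Fin n => z ((Fin.last n).succAbove i))
      (z (Fin.last n)) = z := by
    simpa [initEuclidean] using snocEuclidean_initEuclidean z
  change z ∈ S ↔ snocEuclidean (WithLp.toLp 2 fun i : Fin n => z ((Fin.last n).succAbove i))
      (z (Fin.last n)) ∈ S
  rw [this]

theorem gnomonic_eq (x : EuclideanSpace ℝ (Fin n)) :
    gnomonic n x = ‖snocEuclidean x 1‖⁻¹ • snocEuclidean x 1 := by
  rw [norm_snocEuclidean_one]
  rfl

theorem snocEuclidean_ne_zero {w : EuclideanSpace ℝ (Fin n)} {t : ℝ} (ht : t ≠ 0) :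
    snocEuclidean w t ≠ 0 := fun h => ht <| by
  rw [← snocEuclidean_last w t, h]
  rfl

theorem gnomonic_inv_smul {t : ℝ} (ht : 0 < t) (w : EuclideanSpace ℝ (Fin n)) :
    gnomonic n (t⁻¹ • w) = ‖snocEuclidean w t‖⁻¹ • snocEuclidean w t := by
  have h : snocEuclidean (t⁻¹ • w) 1 = t⁻¹ • snocEuclidean w t := by
    rw [smul_snocEuclidean, inv_mul_cancel₀ ht.ne']
  rw [gnomonic_eq, h, norm_smul, smul_smul, norm_inv, Real.norm_of_nonneg ht.le, mul_inv,
    inv_inv, mul_right_comm, mul_inv_cancel₀ ht.ne', one_mul]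

theorem contDiff_gnomonic : ContDiff ℝ 1 (gnomonic n) := by
  have h : gnomonic n = fun x => ‖snocEuclidean x 1‖⁻¹ • snocEuclidean x 1 :=
    funext gnomonic_eq
  rw [h]
  have h0 : ∀ x : EuclideanSpace ℝ (Fin n), snocEuclidean x 1 ≠ 0 :=
    fun x => snocEuclidean_ne_zero one_ne_zero
  exact ((contDiff_snocEuclidean_one.norm ℝ h0).inv fun x => norm_ne_zero_iff.2 (h0 x)).smul
    contDiff_snocEuclidean_one

theorem mem_hemisphere {y : EuclideanSpace ℝ (Fin (n + 1))} :
    y ∈ hemisphere n ↔ ‖y‖ = 1 ∧ 0 < y (Fin.last n) := by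
  simp [hemisphere, unitSphereSet, pole, EuclideanSpace.inner_single_right]

theorem gnomonic_mem_hemisphere (x : EuclideanSpace ℝ (Fin n)) :
    gnomonic n x ∈ hemisphere n := by
  have h0 : 0 < ‖snocEuclidean x 1‖ := norm_pos_iff.2 (snocEuclidean_ne_zero one_ne_zero)
  rw [mem_hemisphere, gnomonic_eq]
  refine ⟨by simp [norm_smul, h0.ne'], ?_⟩
  simpa using norm_pos_iff.1 h0

theorem gnomonic_of_mem_hemisphere {y : EuclideanSpace ℝ (Fin (n + 1))}
    (hy : y ∈ hemisphere n) : gnomonic n ((y (Fin.last n))⁻¹ • initEuclidean y) = y := by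
  rw [mem_hemisphere] at hy
  rw [gnomonic_inv_smul hy.2, snocEuclidean_initEuclidean, hy.1, inv_one, one_smul]

theorem measurableSet_hemisphere : MeasurableSet (hemisphere n) := by
  have h : hemisphere n = {y | ‖y‖ = 1} ∩ {y | 0 < y (Fin.last n)} := by
    ext y
    exact mem_hemisphere
  rw [h]
  exact (isClosed_eq continuous_norm continuous_const).measurableSet.inter
    (isOpen_lt continuous_const (by fun_prop)).measurableSet

end coordinates

section hausdorff

variable {n : ℕ}

theorem isAddHaarMeasure_hausdorffMeasure_euclideanSpace :
    (μH[(n : ℝ)] : Measure (EuclideanSpace ℝ (Fin n))).IsAddHaarMeasure := by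
  have := isAddHaarMeasure_hausdorffMeasure (E := EuclideanSpace ℝ (Fin n))
  rwa [finrank_euclideanSpace_fin] at this

theorem pole_mem_hemisphere : pole n ∈ hemisphere n := by
  simp [mem_hemisphere, pole]

theorem initEuclidean_pole : initEuclidean (pole n) = 0 := by
  ext i
  simp [pole]

theorem exists_measure_ball_pole_lt_top : ∃ ε > 0,
    (μH[(n : ℝ)] : Measure (EuclideanSpace ℝ (Fin (n + 1)))).restrict (Metric.sphere 0 1)
      (Metric.ball (pole n) ε) < ∞ := by
  have := isAddHaarMeasure_hausdorffMeasure_euclideanSpace (n := n)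
  obtain ⟨K, t, ht, hK⟩ :=
    (contDiff_gnomonic (n := n)).contDiffAt (x := 0) |>.exists_lipschitzOnWith
  have hφ : ContinuousAt (fun y : EuclideanSpace ℝ (Fin (n + 1)) =>
      (y (Fin.last n))⁻¹ • initEuclidean y) (pole n) := by
    have hlast : Continuous fun y : EuclideanSpace ℝ (Fin (n + 1)) => y (Fin.last n) := by
      fun_prop
    refine (hlast.continuousAt.inv₀ ?_).smul lipschitzWith_initEuclidean.continuous.continuousAt
    exact (mem_hemisphere.1 pole_mem_hemisphere).2.ne'
  have h1 : ∀ᶠ y in nhds (pole n),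
      (y (Fin.last n))⁻¹ • initEuclidean y ∈ t ∩ Metric.ball 0 1 := by
    refine hφ.eventually_mem ?_
    rw [initEuclidean_pole, smul_zero]
    exact Filter.inter_mem ht (Metric.ball_mem_nhds 0 one_pos)
  have h2 : ∀ᶠ y in nhds (pole n), 0 < y (Fin.last n) :=
    (isOpen_lt continuous_const (by fun_prop :
      Continuous fun y : EuclideanSpace ℝ (Fin (n + 1)) => y (Fin.last n))).mem_nhds
      (mem_hemisphere.1 pole_mem_hemisphere).2
  obtain ⟨ε, hε, hsub⟩ := Metric.mem_nhds_iff.1 (h1.and h2)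
  refine ⟨ε, hε, ?_⟩
  rw [Measure.restrict_apply measurableSet_ball]
  calc (μH[(n : ℝ)] : Measure (EuclideanSpace ℝ (Fin (n + 1))))
        (Metric.ball (pole n) ε ∩ Metric.sphere 0 1)
      ≤ μH[(n : ℝ)] (gnomonic n '' (t ∩ Metric.ball 0 1)) := by
        refine measure_mono fun y hy => ?_
        obtain ⟨hyt, hy0⟩ := hsub hy.1
        exact ⟨_, hyt, gnomonic_of_mem_hemisphere
          (mem_hemisphere.2 ⟨by simpa using hy.2, hy0⟩)⟩
    _ ≤ (K : ℝ≥0∞) ^ (n : ℝ) * μH[(n : ℝ)] (t ∩ Metric.ball 0 1) :=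
        (hK.mono Set.inter_subset_left).hausdorffMeasure_image_le n.cast_nonneg
    _ < ∞ := ENNReal.mul_lt_top
        (ENNReal.rpow_lt_top_of_nonneg n.cast_nonneg ENNReal.coe_ne_top)
        ((measure_mono Set.inter_subset_right).trans_lt measure_ball_lt_top)

instance isFiniteMeasure_restrict_sphere_hausdorffMeasure : IsFiniteMeasure
    ((μH[(n : ℝ)] : Measure (EuclideanSpace ℝ (Fin (n + 1)))).restrict
      (Metric.sphere 0 1)) := by
  obtain ⟨ε, hε, hlt⟩ := exists_measure_ball_pole_lt_top (n := n)
  have h := (isCompact_sphere (0 : EuclideanSpace ℝ (Fin (n + 1))) 1).measure_lt_top_of_nhdsWithin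
    (μ := (μH[(n : ℝ)]).restrict (Metric.sphere 0 1)) fun x hx => by
      refine ⟨_, mem_nhdsWithin_of_mem_nhds (Metric.ball_mem_nhds x hε), ?_⟩
      rwa [measure_ball_eq_of_measurePreserving
        (measurePreserving_restrict_sphere_hausdorffMeasure _) (y := pole n)]
      rw [(mem_hemisphere.1 pole_mem_hemisphere).1]
      simpa using hx
  exact ⟨by simpa using h⟩

theorem restrict_sphere_hausdorffMeasure_ne_zero :
    (μH[(n : ℝ)] : Measure (EuclideanSpace ℝ (Fin (n + 1)))).restrict (Metric.sphere 0 1) ≠ 0 := by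
  have := isAddHaarMeasure_hausdorffMeasure_euclideanSpace (n := n)
  rw [Ne, Measure.restrict_eq_zero]
  intro h0
  have hsub : Metric.ball 0 1 ⊆
      initEuclidean '' Metric.sphere (0 : EuclideanSpace ℝ (Fin (n + 1))) 1 := by
    intro w hw
    rw [mem_ball_zero_iff] at hw
    refine ⟨snocEuclidean w √(1 - ‖w‖ ^ 2), ?_, initEuclidean_snocEuclidean _ _⟩
    rw [mem_sphere_zero_iff_norm, ← sq_eq_sq₀ (norm_nonneg _) zero_le_one,
      norm_snocEuclidean_sq, Real.sq_sqrt (by nlinarith [norm_nonneg w])]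
    ring
  refine (Metric.measure_ball_pos (μH[(n : ℝ)] : Measure (EuclideanSpace ℝ (Fin n)))
    0 one_pos).ne' (le_antisymm ?_ zero_le)
  refine (measure_mono hsub).trans
    ((lipschitzWith_initEuclidean.hausdorffMeasure_image_le n.cast_nonneg _).trans ?_)
  simp [h0]

theorem exists_restrict_sphere_hausdorffMeasure_eq_smul_coneMeasure :
    ∃ c : ℝ≥0∞, c ≠ 0 ∧ c ≠ ∞ ∧
      (μH[(n : ℝ)] : Measure (EuclideanSpace ℝ (Fin (n + 1)))).restrict (Metric.sphere 0 1) =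
        c • coneMeasure (EuclideanSpace ℝ (Fin (n + 1))) := by
  have hnorm : ∀ x ∈ Metric.sphere (0 : EuclideanSpace ℝ (Fin (n + 1))) 1, ‖x‖ = ‖pole n‖ := by
    intro x hx
    rw [(mem_hemisphere.1 pole_mem_hemisphere).1]
    simpa using hx
  refine exists_eq_smul_of_measure_ball_eq ?_ coneMeasure_compl_sphere
    (fun x hx => measure_ball_eq_of_measurePreserving
      (measurePreserving_restrict_sphere_hausdorffMeasure _) (hnorm x hx))
    (fun x hx => measure_ball_eq_of_measurePreserving measurePreserving_coneMeasure (hnorm x hx))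
    restrict_sphere_hausdorffMeasure_ne_zero coneMeasure_ne_zero
  rw [Measure.restrict_apply Metric.isClosed_sphere.measurableSet.compl, Set.compl_inter_self,
    measure_empty]

end hausdorff

section density

variable {n : ℕ}

theorem cauchyDensity_pos (x : EuclideanSpace ℝ (Fin n)) : 0 < cauchyDensity n x :=
  Real.rpow_pos_of_pos (by positivity) _

theorem continuous_cauchyDensity : Continuous (cauchyDensity n) := by
  unfold cauchyDensity
  exact Continuous.rpow_const (by fun_prop) fun x => Or.inl (by positivity)

theorem integrable_cauchyDensity : Integrable (cauchyDensity n) := by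
  have h := integrable_rpow_neg_one_add_norm_sq (E := EuclideanSpace ℝ (Fin n))
    (μ := volume) (r := (n : ℝ) + 1) (by simp)
  simp only [neg_div] at h
  exact h

theorem integral_cauchyDensity_pos : 0 < ∫ x, cauchyDensity n x :=
  integral_pos_of_integrable_nonneg_nonzero (x := 0) continuous_cauchyDensity
    integrable_cauchyDensity (fun x => (cauchyDensity_pos x).le) (cauchyDensity_pos 0).ne'

theorem cauchyMeasure_apply {B : Set (EuclideanSpace ℝ (Fin n))} (hB : MeasurableSet B) :
    cauchyMeasure n B = (∫⁻ x in B, ENNReal.ofReal (cauchyDensity n x)) /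
      ∫⁻ x, ENNReal.ofReal (cauchyDensity n x) := by
  have hc : 0 ≤ cauchyConst n := inv_nonneg.2 integral_cauchyDensity_pos.le
  rw [cauchyMeasure, withDensity_apply _ hB]
  simp_rw [ENNReal.ofReal_mul hc]
  rw [lintegral_const_mul _ continuous_cauchyDensity.measurable.ennreal_ofReal,
    ← ofReal_integral_eq_lintegral_ofReal integrable_cauchyDensity
      (Filter.Eventually.of_forall fun x => (cauchyDensity_pos x).le),
    cauchyConst, ENNReal.ofReal_inv_of_pos integral_cauchyDensity_pos, mul_comm, div_eq_mul_inv]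

theorem inv_sqrt_one_add_norm_sq_pow (x : EuclideanSpace ℝ (Fin n)) :
    (√(1 + ‖x‖ ^ 2))⁻¹ ^ (n + 1) = cauchyDensity n x := by
  have h : 0 ≤ 1 + ‖x‖ ^ 2 := by positivity
  rw [cauchyDensity, Real.sqrt_eq_rpow, ← Real.rpow_neg h, ← Real.rpow_natCast,
    ← Real.rpow_mul h]
  congr 1
  push_cast
  ring

theorem lintegral_pow_Ioo {ρ : ℝ} (hρ : 0 ≤ ρ) (n : ℕ) :
    ∫⁻ t in Set.Ioo 0 ρ, ENNReal.ofReal (t ^ n) = ENNReal.ofReal (ρ ^ (n + 1) / (n + 1)) := by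
  have hint : IntegrableOn (fun t : ℝ => t ^ n) (Set.Ioo 0 ρ) :=
    ((continuous_pow n).integrableOn_Icc (a := 0) (b := ρ)).mono_set Set.Ioo_subset_Icc_self
  rw [← ofReal_integral_eq_lintegral_ofReal hint, ← integral_Ioc_eq_integral_Ioo,
    ← intervalIntegral.integral_of_le hρ, integral_pow]
  · simp
  · filter_upwards [ae_restrict_mem measurableSet_Ioo] with t ht
    exact pow_nonneg ht.1.le n

theorem coneMeasure_inter_hemisphere {A : Set (EuclideanSpace ℝ (Fin (n + 1)))}
    (hA : MeasurableSet A) :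
    coneMeasure (EuclideanSpace ℝ (Fin (n + 1))) (A ∩ hemisphere n) =
      ENNReal.ofReal ((n : ℝ) + 1)⁻¹ *
        ∫⁻ x in gnomonic n ⁻¹' A, ENNReal.ofReal (cauchyDensity n x) := by
  have hAH := hA.inter (measurableSet_hemisphere (n := n))
  have hB : MeasurableSet (gnomonic n ⁻¹' A) := contDiff_gnomonic.continuous.measurable hA
  set T : Set (ℝ × EuclideanSpace ℝ (Fin n)) :=
    {p | 0 < p.1 ∧ p.1 < (√(1 + ‖p.2‖ ^ 2))⁻¹ ∧ gnomonic n p.2 ∈ A} with hT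
  have hTm : MeasurableSet T := by
    refine (measurableSet_lt measurable_const measurable_fst).inter
      ((measurableSet_lt measurable_fst ?_).inter (measurable_snd hB))
    fun_prop
  have hslice : ∀ t : ℝ, volume {w : EuclideanSpace ℝ (Fin n) |
      snocEuclidean w t ∈ {z | ‖z‖ < 1 ∧ ‖z‖⁻¹ • z ∈ A ∩ hemisphere n}} =
      ∫⁻ x, T.indicator (fun p => ENNReal.ofReal (p.1 ^ n)) (t, x) := by
    intro t
    rcases le_or_gt t 0 with ht | ht
    · have h1 : {w : EuclideanSpace ℝ (Fin n) |
          snocEuclidean w t ∈ {z | ‖z‖ < 1 ∧ ‖z‖⁻¹ • z ∈ A ∩ hemisphere n}} = ∅ := by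
        refine Set.eq_empty_of_forall_notMem fun w hw => ?_
        have h2 := (mem_hemisphere.1 hw.2.2).2
        simp only [PiLp.smul_apply, snocEuclidean_last, smul_eq_mul] at h2
        exact h2.not_ge (mul_nonpos_of_nonneg_of_nonpos (by positivity) ht)
      have h2 : ∀ x, T.indicator (fun p => ENNReal.ofReal (p.1 ^ n)) (t, x) = 0 := fun x =>
        Set.indicator_of_notMem (fun h => ht.not_gt h.1) _
      rw [h1, measure_empty, lintegral_congr h2, lintegral_zero]
    · have h1 : {w : EuclideanSpace ℝ (Fin n) |
          snocEuclidean w t ∈ {z | ‖z‖ < 1 ∧ ‖z‖⁻¹ • z ∈ A ∩ hemisphere n}} =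
          (fun w => t⁻¹ • w) ⁻¹' {x | (t, x) ∈ T} := by
        ext w
        have h3 : ‖snocEuclidean w t‖ < 1 ↔ t < (√(1 + ‖t⁻¹ • w‖ ^ 2))⁻¹ := by
          have h4 : snocEuclidean w t = t • snocEuclidean (t⁻¹ • w) 1 := by
            rw [smul_snocEuclidean, smul_inv_smul₀ ht.ne', mul_one]
          rw [h4, norm_smul, norm_snocEuclidean_one, Real.norm_of_nonneg ht.le,
            lt_inv_comm₀ ht (by positivity), ← one_div, lt_div_iff₀ ht, mul_comm]
        simp only [Set.mem_ofPred_eq, Set.mem_preimage, hT, ← gnomonic_inv_smul ht, h3,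
          Set.mem_inter_iff, gnomonic_mem_hemisphere, ht, and_true, true_and]
      rw [h1, Measure.addHaar_preimage_smul _ (inv_ne_zero ht.ne'), finrank_euclideanSpace_fin,
        inv_pow, inv_inv, abs_of_pos (pow_pos ht n)]
      have hm : MeasurableSet {x | (t, x) ∈ T} := measurable_prodMk_left hTm
      rw [← setLIntegral_const, ← lintegral_indicator hm]
      rfl
  have hmeas : Measurable (T.indicator fun p => ENNReal.ofReal (p.1 ^ n)) :=
    (by fun_prop : Measurable fun p : ℝ × EuclideanSpace ℝ (Fin n) =>
      ENNReal.ofReal (p.1 ^ n)).indicator hTm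
  have hcone : MeasurableSet {z : EuclideanSpace ℝ (Fin (n + 1)) |
      ‖z‖ < 1 ∧ ‖z‖⁻¹ • z ∈ A ∩ hemisphere n} :=
    (measurableSet_lt measurable_norm measurable_const).inter (measurable_norm_inv_smul hAH)
  rw [coneMeasure_apply hAH, volume_eq_lintegral_snocEuclidean hcone]
  simp_rw [hslice]
  rw [lintegral_lintegral_swap (f := fun t x =>
      T.indicator (fun p => ENNReal.ofReal (p.1 ^ n)) (t, x)) hmeas.aemeasurable,
    ← lintegral_const_mul _ continuous_cauchyDensity.measurable.ennreal_ofReal,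
    ← lintegral_indicator hB]
  congr 1
  ext x
  by_cases hx : x ∈ gnomonic n ⁻¹' A
  · rw [Set.indicator_of_mem hx, ← ENNReal.ofReal_mul (by positivity), inv_mul_eq_div,
      ← inv_sqrt_one_add_norm_sq_pow, ← lintegral_pow_Ioo (by positivity),
      ← lintegral_indicator measurableSet_Ioo]
    congr 1
    ext t
    have hiff : (t, x) ∈ T ↔ t ∈ Set.Ioo 0 (√(1 + ‖x‖ ^ 2))⁻¹ :=
      ⟨fun h => ⟨h.1, h.2.1⟩, fun h => ⟨h.1, h.2, hx⟩⟩
    simp only [Set.indicator, hiff]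
  · rw [Set.indicator_of_notMem hx]
    refine (lintegral_congr fun t => ?_).trans lintegral_zero
    exact Set.indicator_of_notMem (fun h => hx h.2.2) _

end density


/-- The pushforward of the Cauchy measure `ν_n` under the gnomonic
projection is the normalized Riemannian (Hausdorff) volume of the open hemisphere. -/
theorem gnomonic_pushforward_cauchy (n : ℕ) (hn : 1 ≤ n)
    (A : Set (EuclideanSpace ℝ (Fin (n + 1)))) (hA : MeasurableSet A) :
    cauchyMeasure n (gnomonic n ⁻¹' A) =
      μH[(n : ℝ)] (A ∩ hemisphere n) / μH[(n : ℝ)] (hemisphere n) := by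
  obtain ⟨c, hc0, hctop, hc⟩ :=
    exists_restrict_sphere_hausdorffMeasure_eq_smul_coneMeasure (n := n)
  have key : ∀ B : Set (EuclideanSpace ℝ (Fin (n + 1))), MeasurableSet B →
      μH[(n : ℝ)] (B ∩ hemisphere n) = c * ENNReal.ofReal ((n : ℝ) + 1)⁻¹ *
        ∫⁻ x in gnomonic n ⁻¹' B, ENNReal.ofReal (cauchyDensity n x) := by
    intro B hB
    have hsub : B ∩ hemisphere n ⊆ Metric.sphere 0 1 := fun y hy => hy.2.1
    rw [mul_assoc, ← coneMeasure_inter_hemisphere hB, ← Measure.restrict_eq_self _ hsub, hc]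
    rfl
  have huniv := key Set.univ MeasurableSet.univ
  rw [Set.univ_inter, Set.preimage_univ, Measure.restrict_univ] at huniv
  have hpos : (0 : ℝ) < ((n : ℝ) + 1)⁻¹ := by positivity
  rw [key A hA, huniv, ENNReal.mul_div_mul_left _ _
      (mul_ne_zero hc0 (ENNReal.ofReal_pos.2 hpos).ne')
      (ENNReal.mul_ne_top hctop ENNReal.ofReal_ne_top),
    cauchyMeasure_apply (contDiff_gnomonic.continuous.measurable hA)]
end

section
/- The Cauchy correlation inequality holds when one of the sets is a centered Euclidean ball: for every n ≥ 1, every convex set K ⊆ ℝ^n with 0 ∈ K, and every r > 0, letting B be the closed Euclidean ball of radius r centered at the origin, one has ν_n(K ∩ B) ≥ ν_n(K)·ν_n(B). -/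
open MeasureTheory Real
open scoped RealInnerProductSpace ENNReal

namespace MeasureTheory

variable {E : Type*} [NormedAddCommGroup E] [NormedSpace ℝ E] [FiniteDimensional ℝ E]
  [MeasurableSpace E] [BorelSpace E] [Nontrivial E]

/-- Polar coordinates for a measure with a radial density. -/
theorem withDensity_norm_apply_eq_lintegral_toSphere (μ : Measure E) [μ.IsAddHaarMeasure]
    {g : ℝ → ℝ≥0∞} (hg : Measurable g) {S : Set E} (hS : MeasurableSet S) :
    μ.withDensity (fun x => g ‖x‖) S =
      ∫⁻ θ, (Measure.volumeIoiPow (Module.finrank ℝ E - 1)).withDensity (fun t => g t)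
        {t | (t : ℝ) • (θ : E) ∈ S} ∂μ.toSphere := by
  have hpre : MeasurableSet {p : Metric.sphere (0 : E) 1 × Set.Ioi (0 : ℝ) |
      (p.2 : ℝ) • (p.1 : E) ∈ S} := by
    have : Measurable fun p : Metric.sphere (0 : E) 1 × Set.Ioi (0 : ℝ) =>
        (p.2 : ℝ) • (p.1 : E) := by fun_prop
    exact this hS
  have hgp : Measurable fun p : Metric.sphere (0 : E) 1 × Set.Ioi (0 : ℝ) => g p.2 := by fun_prop
  calc μ.withDensity (fun x => g ‖x‖) S
      = ∫⁻ x, S.indicator (fun x => g ‖x‖) x ∂μ := by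
        rw [withDensity_apply _ hS, lintegral_indicator hS]
    _ = ∫⁻ x : ({0}ᶜ : Set E), S.indicator (fun x => g ‖x‖) x ∂(μ.comap (↑)) := by
        rw [lintegral_subtype_comap (MeasurableSet.singleton _).compl
          (S.indicator fun x => g ‖x‖), restrict_compl_singleton]
    _ = ∫⁻ p, {p : Metric.sphere (0 : E) 1 × Set.Ioi (0 : ℝ) |
          (p.2 : ℝ) • (p.1 : E) ∈ S}.indicator (fun p => g p.2) p
          ∂(μ.toSphere.prod (.volumeIoiPow (Module.finrank ℝ E - 1))) := by
        rw [← μ.measurePreserving_homeomorphUnitSphereProd.lintegral_comp_emb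
          (Homeomorph.measurableEmbedding _)]
        refine lintegral_congr fun x => ?_
        have hx : ‖(x : E)‖ ≠ 0 := norm_ne_zero_iff.2 x.2
        have hpolar : ((homeomorphUnitSphereProd E x).2 : ℝ) •
            ((homeomorphUnitSphereProd E x).1 : E) = x := by
          simp [smul_smul, hx]
        by_cases hxS : (x : E) ∈ S
        · rw [Set.indicator_of_mem hxS, Set.indicator_of_mem (by rwa [← hpolar] at hxS),
            homeomorphUnitSphereProd_apply_snd_coe]
        · rw [Set.indicator_of_notMem hxS, Set.indicator_of_notMem (by rwa [← hpolar] at hxS)]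
    _ = _ := by
        rw [lintegral_prod _ (hgp.indicator hpre).aemeasurable]
        refine lintegral_congr fun θ => ?_
        have hθ : MeasurableSet {t : Set.Ioi (0 : ℝ) | (t : ℝ) • (θ : E) ∈ S} :=
          measurable_prodMk_left hpre
        rw [withDensity_apply _ hθ, ← lintegral_indicator hθ]
        rfl

/-- A measurable set that is star-shaped about the origin is positively correlated with centered
balls, for every sub-probability measure with a radial density. -/
theorem withDensity_norm_mul_closedBall_le_of_starConvex (μ : Measure E) [μ.IsAddHaarMeasure]
    {g : ℝ → ℝ≥0∞} (hg : Measurable g) (h1 : μ.withDensity (fun x => g ‖x‖) Set.univ ≤ 1)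
    {S : Set E} (hS : MeasurableSet S) (hstar : StarConvex ℝ 0 S) (r : ℝ) :
    μ.withDensity (fun x => g ‖x‖) S * μ.withDensity (fun x => g ‖x‖) (Metric.closedBall 0 r) ≤
      μ.withDensity (fun x => g ‖x‖) (S ∩ Metric.closedBall 0 r) := by
  set m := μ.withDensity fun x => g ‖x‖
  set ρ := (Measure.volumeIoiPow (Module.finrank ℝ E - 1)).withDensity (fun t => g t)
  have polar {T : Set E} (hT : MeasurableSet T) :
      m T = ∫⁻ θ, ρ {t | (t : ℝ) • (θ : E) ∈ T} ∂μ.toSphere :=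
    withDensity_norm_apply_eq_lintegral_toSphere μ hg hT
  have norm_smul_sphere (t : Set.Ioi (0 : ℝ)) (θ : Metric.sphere (0 : E) 1) :
      ‖(t : ℝ) • (θ : E)‖ = t := by
    simp [norm_smul, abs_of_pos (show (0 : ℝ) < t from t.2)]
  have hball : m (Metric.closedBall 0 r) = ρ {t | (t : ℝ) ≤ r} * μ.toSphere Set.univ := by
    rw [polar Metric.isClosed_closedBall.measurableSet]
    simp only [mem_closedBall_zero_iff, norm_smul_sphere, lintegral_const]
  have huniv : ρ Set.univ * μ.toSphere Set.univ ≤ 1 := by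
    rw [polar MeasurableSet.univ] at h1
    simpa using h1
  have hball1 : m (Metric.closedBall 0 r) ≤ 1 := (measure_mono (Set.subset_univ _)).trans h1
  have hne : m (Metric.closedBall 0 r) ≠ ∞ := ne_top_of_le_ne_top ENNReal.one_ne_top hball1
  rw [polar hS, polar (hS.inter Metric.isClosed_closedBall.measurableSet),
    ← lintegral_mul_const' _ _ hne]
  refine lintegral_mono fun θ => ?_
  simp only [Set.mem_inter_iff, mem_closedBall_zero_iff, norm_smul_sphere]
  by_cases h : ∃ t : Set.Ioi (0 : ℝ), (t : ℝ) • (θ : E) ∈ S ∧ r < t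
  · obtain ⟨t, ht, hrt⟩ := h
    have hsub : {s : Set.Ioi (0 : ℝ) | (s : ℝ) ≤ r} ⊆
        {s : Set.Ioi (0 : ℝ) | (s : ℝ) • (θ : E) ∈ S ∧ (s : ℝ) ≤ r} := by
      intro s hs
      have ht0 : (0 : ℝ) < t := t.2
      have hs0 : (0 : ℝ) < s := s.2
      have hst : (s : ℝ) ≤ t := le_trans hs hrt.le
      refine ⟨?_, hs⟩
      have := hstar.smul_mem ht (div_nonneg hs0.le ht0.le) ((div_le_one ht0).2 hst)
      rwa [smul_smul, div_mul_cancel₀ _ ht0.ne'] at this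
    calc ρ {t | (t : ℝ) • (θ : E) ∈ S} * m (Metric.closedBall 0 r)
        ≤ ρ Set.univ * (ρ {t | (t : ℝ) ≤ r} * μ.toSphere Set.univ) := by
          rw [hball]
          gcongr
          exact Set.subset_univ _
      _ = (ρ Set.univ * μ.toSphere Set.univ) * ρ {t | (t : ℝ) ≤ r} := by ring
      _ ≤ 1 * ρ {t | (t : ℝ) ≤ r} := by gcongr
      _ ≤ _ := by
          rw [one_mul]
          exact measure_mono hsub
  · push Not at h
    calc ρ {t | (t : ℝ) • (θ : E) ∈ S} * m (Metric.closedBall 0 r)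
        ≤ ρ {t | (t : ℝ) • (θ : E) ∈ S} * 1 := by gcongr
      _ ≤ _ := by
          rw [mul_one]
          exact measure_mono fun t ht => ⟨ht, h t ht⟩

end MeasureTheory

theorem cauchyDensity_nonneg (n : ℕ) (x : EuclideanSpace ℝ (Fin n)) : 0 ≤ cauchyDensity n x := by
  unfold cauchyDensity
  positivity

theorem cauchyMeasure_univ_le_one (n : ℕ) : cauchyMeasure n Set.univ ≤ 1 := by
  have hc : 0 ≤ cauchyConst n := inv_nonneg.2 (integral_nonneg (cauchyDensity_nonneg n))
  rw [cauchyMeasure, withDensity_apply _ MeasurableSet.univ, Measure.restrict_univ]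
  by_cases hi : Integrable (cauchyDensity n)
  · rw [← ofReal_integral_eq_lintegral_ofReal (hi.const_mul _)
      (Filter.Eventually.of_forall fun x => mul_nonneg hc (cauchyDensity_nonneg n x)),
      integral_const_mul]
    exact ENNReal.ofReal_le_one.2 inv_mul_le_one
  · simp [cauchyConst, integral_undef hi]

/-- The Cauchy correlation inequality holds when one of the sets is a
centered Euclidean ball. -/
theorem cauchy_correlation_ball (n : ℕ) (hn : 1 ≤ n)
    (K : Set (EuclideanSpace ℝ (Fin n))) (hK : Convex ℝ K) (h0K : (0 : _) ∈ K)
    (r : ℝ) (hr : 0 < r) :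
    cauchyMeasure n (K ∩ Metric.closedBall 0 r) ≥
      cauchyMeasure n K * cauchyMeasure n (Metric.closedBall 0 r) := by
  have : Nonempty (Fin n) := ⟨⟨0, hn⟩⟩
  let g : ℝ → ℝ≥0∞ := fun t =>
    ENNReal.ofReal (cauchyConst n * (1 + t ^ 2) ^ (-(((n : ℝ) + 1) / 2)))
  have hgm : Measurable g := by unfold g; fun_prop
  have hν : cauchyMeasure n = volume.withDensity fun x => g ‖x‖ := rfl
  have hac : cauchyMeasure n ≪ volume := withDensity_absolutelyContinuous _ _
  have hclosure : cauchyMeasure n (closure K ∩ Metric.closedBall 0 r) ≤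
      cauchyMeasure n (K ∩ Metric.closedBall 0 r) := by
    have hsub : closure K ∩ Metric.closedBall 0 r ⊆
        (K ∩ Metric.closedBall 0 r) ∪ frontier K := by
      rw [closure_eq_self_union_frontier]
      rintro x ⟨hx | hx, hxr⟩
      exacts [Or.inl ⟨hx, hxr⟩, Or.inr hx]
    calc _ ≤ _ := measure_mono hsub
      _ ≤ _ := measure_union_le _ _
      _ = _ := by rw [hac (hK.addHaar_frontier volume), add_zero]
  calc cauchyMeasure n K * cauchyMeasure n (Metric.closedBall 0 r)
      ≤ cauchyMeasure n (closure K) * cauchyMeasure n (Metric.closedBall 0 r) := by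
        gcongr
        exact subset_closure
    _ ≤ cauchyMeasure n (closure K ∩ Metric.closedBall 0 r) := by
        have h1 := cauchyMeasure_univ_le_one n
        rw [hν] at h1 ⊢
        exact withDensity_norm_mul_closedBall_le_of_starConvex volume hgm h1
          isClosed_closure.measurableSet (hK.closure.starConvex (subset_closure h0K)) r
    _ ≤ _ := hclosure
end

section
/- Bishop–Gromov monotonicity for convex subsets of the hemisphere: let K₀ ⊆ ℝ^n be an open convex set and let S = q(K₀) ⊆ S^n_+ be its gnomonic image (a geodesically convex open subset of the open hemisphere). Then for every x ∈ S, the function r ↦ μ_n(S ∩ B_S(x,r)) / μ_n(B_S(x,r)) is non-increasing on (0, π]. -/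
open MeasureTheory Real
open scoped RealInnerProductSpace ENNReal

/-- Closed geodesic ball on the unit sphere: `B_S(p, r) = {y ∈ Sⁿ : ⟪y, p⟫ ≥ cos r}`. -/
noncomputable def geodesicBall (n : ℕ) (p : EuclideanSpace ℝ (Fin (n + 1))) (r : ℝ) :
    Set (EuclideanSpace ℝ (Fin (n + 1))) :=
  {y ∈ unitSphereSet n | Real.cos r ≤ ⟪y, p⟫}

open Metric Set Filter Topology

section Uniqueness

variable {E : Type*} [NormedAddCommGroup E] [InnerProductSpace ℝ E] [MeasurableSpace E]
  [BorelSpace E]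

/-- A measure invariant under linear isometries gives the same mass to balls of equal radius
centered at points of equal norm. -/
lemma measure_closedBall_eq_of_norm_eq {μ : Measure E}
    (hμ : ∀ e : E ≃ₗᵢ[ℝ] E, MeasurePreserving e μ μ) {x y : E} (hxy : ‖x‖ = ‖y‖) (r : ℝ) :
    μ (closedBall x r) = μ (closedBall y r) := by
  obtain ⟨e, he⟩ : ∃ e : E ≃ₗᵢ[ℝ] E, e x = y := ⟨_, Submodule.reflection_sub hxy⟩
  have h := (hμ e).measure_preimage (isClosed_closedBall (x := y) (ε := r)).nullMeasurableSet
  rw [← h, e.preimage_closedBall, ← he, e.symm_apply_apply]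

variable [FiniteDimensional ℝ E]

/-- The density of one isometry-invariant measure on the unit sphere with respect to another
is constant. -/
lemma exists_rnDeriv_ae_eq_const {μ ν : Measure E}
    [IsLocallyFiniteMeasure μ] [IsLocallyFiniteMeasure ν]
    (hμ : ∀ e : E ≃ₗᵢ[ℝ] E, MeasurePreserving e μ μ)
    (hν : ∀ e : E ≃ₗᵢ[ℝ] E, MeasurePreserving e ν ν)
    (hμs : μ (sphere 0 1)ᶜ = 0) (hμ0 : μ ≠ 0) :
    ∃ c : ℝ≥0∞, c ≠ ∞ ∧ ν.rnDeriv μ =ᵐ[μ] (fun _ => c) ∧ ∀ x ∈ sphere (0 : E) 1,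
      Tendsto (fun r => ν (closedBall x r) / μ (closedBall x r)) (𝓝[>] 0) (𝓝 c) := by
  have hae : ∀ᵐ x ∂μ, x ∈ sphere (0 : E) 1 := by
    rwa [ae_iff]
  have hlim := Besicovitch.ae_tendsto_rnDeriv ν μ
  have : (ae μ).NeBot := ae_neBot.2 hμ0
  obtain ⟨x₀, ⟨hx₀, hl₀⟩, hf₀⟩ := ((hae.and hlim).and (ν.rnDeriv_lt_top μ)).exists
  have key : ∀ x ∈ sphere (0 : E) 1,
      Tendsto (fun r => ν (closedBall x r) / μ (closedBall x r)) (𝓝[>] 0)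
        (𝓝 (ν.rnDeriv μ x₀)) := by
    intro x hx
    have hn : ‖x‖ = ‖x₀‖ := by
      rw [mem_sphere_zero_iff_norm.1 hx, mem_sphere_zero_iff_norm.1 hx₀]
    simpa only [measure_closedBall_eq_of_norm_eq hμ hn,
      measure_closedBall_eq_of_norm_eq hν hn] using hl₀
  refine ⟨_, hf₀.ne, ?_, key⟩
  filter_upwards [hae, hlim] with x hx hl
  exact tendsto_nhds_unique hl (key x hx)

/-- Two isometry-invariant locally finite measures on the unit sphere are proportional. -/
theorem exists_eq_smul_of_isometry_invariant {μ ν : Measure E}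
    [IsLocallyFiniteMeasure μ] [IsLocallyFiniteMeasure ν]
    (hμ : ∀ e : E ≃ₗᵢ[ℝ] E, MeasurePreserving e μ μ)
    (hν : ∀ e : E ≃ₗᵢ[ℝ] E, MeasurePreserving e ν ν)
    (hμs : μ (sphere 0 1)ᶜ = 0) (hνs : ν (sphere 0 1)ᶜ = 0) (hμ0 : μ ≠ 0) :
    ∃ c : ℝ≥0∞, c ≠ ∞ ∧ ν = c • μ := by
  by_cases hν0 : ν = 0
  · exact ⟨0, by simp, by simp [hν0]⟩
  obtain ⟨c, hc, hcae, hclim⟩ := exists_rnDeriv_ae_eq_const hμ hν hμs hμ0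
  obtain ⟨d, hd, hdae, hdlim⟩ := exists_rnDeriv_ae_eq_const hν hμ hνs hν0
  obtain ⟨p, hp⟩ := μ.nonempty_support hμ0
  have hps : p ∈ sphere (0 : E) 1 :=
    Measure.support_subset_of_isClosed isClosed_sphere (mem_ae_iff.2 hμs) hp
  have hd0 : d ≠ 0 := by
    have hinv : Tendsto (fun r => μ (closedBall p r) / ν (closedBall p r)) (𝓝[>] 0)
        (𝓝 c⁻¹) := by
      refine (hclim p hps).inv.congr' ?_
      filter_upwards [self_mem_nhdsWithin] with r hr
      rw [ENNReal.inv_div (Or.inl measure_closedBall_lt_top.ne)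
        (Or.inl ((Measure.mem_support_iff_forall p).1 hp _
          (closedBall_mem_nhds p hr)).ne')]
    rw [tendsto_nhds_unique (hdlim p hps) hinv]
    exact ENNReal.inv_ne_zero.2 hc
  have hac : ν ≪ μ := by
    have hle : d • ν ≤ μ := by
      rw [← withDensity_const, ← withDensity_congr_ae hdae]
      exact Measure.withDensity_rnDeriv_le μ ν
    intro s hs
    have := hle s
    rw [hs, Measure.smul_apply, smul_eq_mul] at this
    simpa [hd0] using this
  refine ⟨c, hc, ?_⟩
  rw [← withDensity_const, ← withDensity_congr_ae hcae, Measure.withDensity_rnDeriv_eq ν μ hac]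

end Uniqueness

section RadialMeasure

variable (E : Type*) [NormedAddCommGroup E] [InnerProductSpace ℝ E] [FiniteDimensional ℝ E]
  [MeasurableSpace E] [BorelSpace E]

/-- The push-forward of Lebesgue measure on the unit ball under radial projection to the
unit sphere. -/
noncomputable def radialMeasure : Measure E :=
  (volume.restrict (ball (0 : E) 1)).map (fun v => ‖v‖⁻¹ • v)

lemma measurable_normalize : Measurable (fun v : E => ‖v‖⁻¹ • v) := by fun_prop

lemma radialMeasure_apply {A : Set E} (hA : MeasurableSet A) :
    radialMeasure E A = volume ({v | ‖v‖⁻¹ • v ∈ A} ∩ ball (0 : E) 1) := by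
  rw [radialMeasure, Measure.map_apply (measurable_normalize E) hA,
    Measure.restrict_apply (measurable_normalize E hA)]
  rfl

instance : IsFiniteMeasure (radialMeasure E) := by
  have : IsFiniteMeasure (volume.restrict (ball (0 : E) 1)) :=
    ⟨by simpa using measure_ball_lt_top⟩
  unfold radialMeasure
  infer_instance

lemma measurePreserving_radialMeasure (e : E ≃ₗᵢ[ℝ] E) :
    MeasurePreserving e (radialMeasure E) (radialMeasure E) := by
  refine ⟨e.continuous.measurable, ?_⟩
  ext A hA
  have hA' : MeasurableSet (e ⁻¹' A) := e.continuous.measurable hA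
  rw [Measure.map_apply e.continuous.measurable hA, radialMeasure_apply E hA',
    radialMeasure_apply E hA]
  have hm : MeasurableSet ({v : E | ‖v‖⁻¹ • v ∈ A} ∩ ball (0 : E) 1) :=
    (measurable_normalize E hA).inter measurableSet_ball
  rw [← e.measurePreserving.measure_preimage hm.nullMeasurableSet]
  congr 1
  ext v
  simp

lemma radialMeasure_compl_sphere [Nontrivial E] : radialMeasure E (sphere 0 1)ᶜ = 0 := by
  rw [radialMeasure_apply E isClosed_sphere.measurableSet.compl]
  refine measure_mono_null (t := {0}) ?_ (measure_singleton _)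
  rintro v ⟨hv, -⟩
  by_contra h
  have h0 : ‖v‖ ≠ 0 := norm_ne_zero_iff.2 h
  exact hv (by simp [norm_smul, h0])

lemma radialMeasure_pos {U : Set E} (hU : IsOpen U) {x : E} (hx : x ∈ U) (hxs : ‖x‖ = 1) :
    0 < radialMeasure E U := by
  rw [radialMeasure_apply E hU.measurableSet]
  have hx2 : ‖(2⁻¹ : ℝ) • x‖ = 2⁻¹ := by simp [norm_smul, hxs]
  refine Measure.measure_pos_of_mem_nhds volume (x := (2⁻¹ : ℝ) • x) (Filter.inter_mem ?_ ?_)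
  · have hc : ContinuousAt (fun v : E => ‖v‖⁻¹ • v) ((2⁻¹ : ℝ) • x) :=
      (continuousAt_id.norm.inv₀ (by simp only [id]; rw [hx2]; norm_num)).smul continuousAt_id
    refine hc.preimage_mem_nhds (hU.mem_nhds ?_)
    rw [hx2, smul_smul]
    norm_num
    exact hx
  · refine isOpen_ball.mem_nhds ?_
    rw [mem_ball_zero_iff, hx2]
    norm_num

end RadialMeasure

section Polar

/-- If the fibers of `W` are nested with a set `J₁ ⊆ J₂`, the mass of `W` relative to the `J`'s
decreases. -/
lemma measure_inter_mul_le_of_nested {X : Type*} [MeasurableSpace X] (η : Measure X)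
    {W J₁ J₂ : Set X} (hJ : J₁ ⊆ J₂) (hW : W ∩ J₂ ⊆ J₁ ∨ J₁ ⊆ W) :
    η (W ∩ J₂) * η J₁ ≤ η (W ∩ J₁) * η J₂ := by
  rcases hW with h | h
  · exact mul_le_mul' (measure_mono fun y hy => ⟨hy.1, h hy⟩) (measure_mono hJ)
  · rw [inter_eq_right.2 h, mul_comm]
    exact mul_le_mul_right (measure_mono inter_subset_right) _

/-- Polar coordinates: a nontrivial finite-dimensional space carries Lebesgue measure as the image
of a product measure on sphere times half-line. -/
lemma exists_map_polar_eq_volume (F : Type*) [NormedAddCommGroup F] [InnerProductSpace ℝ F]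
    [FiniteDimensional ℝ F] [MeasurableSpace F] [BorelSpace F] [Nontrivial F] :
    ∃ (τ : Measure (sphere (0 : F) 1)) (γ : Measure (Ioi (0 : ℝ))),
      SFinite τ ∧ SFinite γ ∧
        (γ.prod τ).map (fun p => (p.1 : ℝ) • (p.2 : F)) = volume := by
  refine ⟨volume.toSphere, .volumeIoiPow (Module.finrank ℝ F - 1), inferInstance,
    inferInstance, ?_⟩
  have h := (volume : Measure F).measurePreserving_homeomorphUnitSphereProd.symm
    (homeomorphUnitSphereProd F).toMeasurableEquiv
  have h2 : ((volume : Measure F).comap (Subtype.val : ({0}ᶜ : Set F) → F)).map Subtype.val =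
      volume := by
    rw [map_comap_subtype_coe (measurableSet_singleton 0).compl]
    exact Measure.restrict_eq_self_of_ae_mem (by simp [ae_iff])
  rw [← Measure.prod_swap, Measure.map_map (by fun_prop) measurable_swap]
  rw [← h.map_eq, Measure.map_map measurable_subtype_coe h.measurable] at h2
  exact h2


variable {E F : Type*} [NormedAddCommGroup E] [InnerProductSpace ℝ E] [FiniteDimensional ℝ E]
  [MeasurableSpace E] [BorelSpace E] [NormedAddCommGroup F] [InnerProductSpace ℝ F]
  [FiniteDimensional ℝ F] [MeasurableSpace F] [BorelSpace F]

/-- Lebesgue measure is proportional to the image of a product measure under cylindrical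
coordinates around the axis spanned by `x`. -/
lemma exists_map_cylindrical_eq_volume [Nontrivial F] {x : E} (hx : ‖x‖ = 1) (ι : F →ₗᵢ[ℝ] E)
    (hι : LinearMap.range ι.toLinearMap = (ℝ ∙ x)ᗮ) :
    ∃ (c : ℝ≥0∞) (η : Measure (ℝ × Ioi (0 : ℝ))) (τ : Measure (sphere (0 : F) 1)),
      SFinite η ∧ SFinite τ ∧
        c • (η.prod τ).map (fun p => p.1.1 • x + (p.1.2 : ℝ) • ι p.2) = volume := by
  obtain ⟨τ, γ, hτ, hγ, hF⟩ := exists_map_polar_eq_volume F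
  have hxι : ∀ z, ⟪x, ι z⟫ = 0 := fun z =>
    Submodule.mem_orthogonal_singleton_iff_inner_right.1 (hι ▸ LinearMap.mem_range_self _ z)
  let L₀ : ℝ × F →ₗ[ℝ] E :=
    (LinearMap.toSpanSingleton ℝ E x).coprod ι.toLinearMap
  have hL₀ : ∀ p, L₀ p = p.1 • x + ι p.2 := fun p => by simp [L₀]
  have hbij : Function.Bijective L₀ := by
    constructor
    · rw [injective_iff_map_eq_zero]
      rintro ⟨s, z⟩ h
      rw [hL₀] at h
      have hs : s = 0 := by
        have := congrArg (fun y => ⟪x, y⟫) h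
        simpa [inner_add_right, inner_smul_right, hxι, hx] using this
      subst hs
      have hz : z = 0 := ι.injective (by simpa using h)
      rw [hz, Prod.mk_zero_zero]
    · intro y
      have hy : y - ⟪x, y⟫ • x ∈ (ℝ ∙ x)ᗮ := by
        rw [Submodule.mem_orthogonal_singleton_iff_inner_right]
        simp [inner_sub_right, inner_smul_right, hx]
      rw [← hι] at hy
      obtain ⟨z, hz⟩ := hy
      refine ⟨(⟪x, y⟫, z), ?_⟩
      have hz' : ι z = y - ⟪x, y⟫ • x := hz
      rw [hL₀, hz']
      abel
  let L : (ℝ × F) ≃L[ℝ] E := (LinearEquiv.ofBijective L₀ hbij).toContinuousLinearEquiv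
  have hL : ∀ p, L p = p.1 • x + ι p.2 := hL₀
  let μ : Measure (ℝ × F) := (volume : Measure ℝ).prod (volume : Measure F)
  have : (μ.map L).IsAddHaarMeasure := L.isAddHaarMeasure_map μ
  have hvol := Measure.isAddLeftInvariant_eq_smul (volume : Measure E) (μ.map L)
  refine ⟨(Measure.addHaarScalarFactor (volume : Measure E) (μ.map L) : ℝ≥0∞),
    (volume : Measure ℝ).prod γ, τ, inferInstance, hτ, Eq.trans ?_ hvol.symm⟩
  change _ = (Measure.addHaarScalarFactor (volume : Measure E) (μ.map L) : ℝ≥0∞) • μ.map L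
  congr 1
  have hμ : μ = (((volume : Measure ℝ).prod γ).prod τ).map
      (fun p => (p.1.1, (p.1.2 : ℝ) • (p.2 : F))) := by
    have hm : Measurable (fun p : Ioi (0 : ℝ) × sphere (0 : F) 1 => (p.1 : ℝ) • (p.2 : F)) := by
      fun_prop
    have : μ = ((volume : Measure ℝ).map id).prod
        ((γ.prod τ).map (fun p => (p.1 : ℝ) • (p.2 : F))) := by
      rw [hF, Measure.map_id]
    rw [this, Measure.map_prod_map _ _ measurable_id hm, ← Measure.prodAssoc_prod,
      Measure.map_map (measurable_id.prodMap hm) (MeasurableEquiv.measurable _)]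
    rfl
  rw [hμ, Measure.map_map L.continuous.measurable (by fun_prop)]
  congr 1
  ext p
  simp [hL]

/-- The polar angle is monotone in the slope. -/
lemma div_sqrt_le_div_sqrt {s ρ s' ρ' : ℝ} (hρ : 0 < ρ) (hρ' : 0 < ρ') (h : s' * ρ ≤ s * ρ') :
    s' / √(s' ^ 2 + ρ' ^ 2) ≤ s / √(s ^ 2 + ρ ^ 2) := by
  have key : ∀ {u w : ℝ}, 0 < w → u / √(u ^ 2 + w ^ 2) = sin (arctan (u / w)) := by
    intro u w hw
    have h1 : √(1 + (u / w) ^ 2) = √(u ^ 2 + w ^ 2) / w := by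
      rw [← Real.sqrt_sq hw.le, ← Real.sqrt_div (by positivity), Real.sqrt_sq hw.le]
      congr 1
      field_simp
      ring
    rw [Real.sin_arctan, h1]
    field_simp
  rw [key hρ, key hρ']
  refine Real.sin_le_sin_of_le_of_le_pi_div_two (Real.neg_pi_div_two_lt_arctan _).le
    (Real.arctan_lt_pi_div_two _).le (Real.arctan_strictMono.monotone ?_)
  rwa [div_le_div_iff₀ hρ' hρ]

/-- Bishop–Gromov monotonicity for the radial measure and sets which are star-shaped around `x`
in the sphere. -/
theorem radialMeasure_inter_mul_le (hE : 2 ≤ Module.finrank ℝ E) {x : E} (hx : ‖x‖ = 1)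
    {S : Set E} (hS : MeasurableSet S)
    (hstar : ∀ y ∈ S, ∀ a b : ℝ, 0 ≤ a → 0 < b → ‖a • x + b • y‖⁻¹ • (a • x + b • y) ∈ S)
    {t₁ t₂ : ℝ} (ht : t₂ ≤ t₁) :
    radialMeasure E (S ∩ {y ∈ sphere 0 1 | t₂ ≤ ⟪y, x⟫}) *
        radialMeasure E {y ∈ sphere 0 1 | t₁ ≤ ⟪y, x⟫} ≤
      radialMeasure E (S ∩ {y ∈ sphere 0 1 | t₁ ≤ ⟪y, x⟫}) *
        radialMeasure E {y ∈ sphere 0 1 | t₂ ≤ ⟪y, x⟫} := by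
  have hfin : Module.finrank ℝ (ℝ ∙ x)ᗮ + 1 = Module.finrank ℝ E := by
    rw [← (ℝ ∙ x).finrank_add_finrank_orthogonal, add_comm,
      finrank_span_singleton (norm_ne_zero_iff.1 (by rw [hx]; norm_num))]
  have : Nontrivial (ℝ ∙ x)ᗮ := Module.nontrivial_of_finrank_pos (R := ℝ) (by omega)
  obtain ⟨c, η, τ, hη, hτ, hvol⟩ :=
    exists_map_cylindrical_eq_volume hx (ℝ ∙ x)ᗮ.subtypeₗᵢ (by simp)
  set Ψ : (ℝ × Ioi (0 : ℝ)) × sphere (0 : (ℝ ∙ x)ᗮ) 1 → E :=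
    fun p => p.1.1 • x + (p.1.2 : ℝ) • (ℝ ∙ x)ᗮ.subtypeₗᵢ p.2 with hΨdef
  have hΨ : Measurable Ψ := by
    have : Measurable (ℝ ∙ x)ᗮ.subtypeₗᵢ := (ℝ ∙ x)ᗮ.subtypeₗᵢ.continuous.measurable
    fun_prop
  have hB : ∀ t : ℝ, MeasurableSet {y ∈ sphere (0 : E) 1 | t ≤ ⟪y, x⟫} := fun t => by
    have h : IsClosed (sphere (0 : E) 1 ∩ {y | t ≤ ⟪y, x⟫}) :=
      isClosed_sphere.inter (isClosed_le (by fun_prop) (by fun_prop))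
    exact h.measurableSet
  let J : ℝ → Set (ℝ × Ioi (0 : ℝ)) := fun t =>
    {p | √(p.1 ^ 2 + (p.2 : ℝ) ^ 2) < 1 ∧ t ≤ p.1 / √(p.1 ^ 2 + (p.2 : ℝ) ^ 2)}
  let W : sphere (0 : (ℝ ∙ x)ᗮ) 1 → Set (ℝ × Ioi (0 : ℝ)) := fun θ =>
    {p | ‖Ψ (p, θ)‖⁻¹ • Ψ (p, θ) ∈ S}
  have hxθ : ∀ θ : sphere (0 : (ℝ ∙ x)ᗮ) 1, ⟪x, ((θ : (ℝ ∙ x)ᗮ) : E)⟫ = 0 := fun θ =>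
    Submodule.mem_orthogonal_singleton_iff_inner_right.1 θ.1.2
  have hθ : ∀ θ : sphere (0 : (ℝ ∙ x)ᗮ) 1, ‖((θ : (ℝ ∙ x)ᗮ) : E)‖ = 1 := fun θ =>
    mem_sphere_zero_iff_norm.1 θ.2
  have hθx : ∀ θ : sphere (0 : (ℝ ∙ x)ᗮ) 1, ⟪((θ : (ℝ ∙ x)ᗮ) : E), x⟫ = 0 := fun θ => by
    rw [real_inner_comm, hxθ]
  have hΨ' : ∀ p θ, Ψ (p, θ) = p.1 • x + (p.2 : ℝ) • ((θ : (ℝ ∙ x)ᗮ) : E) := fun _ _ => rfl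
  have hnorm : ∀ p θ, ‖Ψ (p, θ)‖ = √(p.1 ^ 2 + (p.2 : ℝ) ^ 2) := by
    intro p θ
    rw [← Real.sqrt_sq (norm_nonneg (Ψ (p, θ)))]
    congr 1
    rw [← real_inner_self_eq_norm_sq]
    simp only [hΨ', inner_add_left, inner_add_right, inner_smul_left, inner_smul_right,
      hxθ, hθx, real_inner_self_eq_norm_sq, hx, hθ, RCLike.conj_to_real]
    ring
  have hnpos : ∀ p θ, 0 < ‖Ψ (p, θ)‖ := by
    intro p θ
    rw [hnorm]
    have : (0 : ℝ) < p.2 := p.2.2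
    positivity
  have hinner : ∀ p θ, ⟪Ψ (p, θ), x⟫ = p.1 := by
    intro p θ
    simp only [hΨ', inner_add_left, inner_smul_left, hθx, real_inner_self_eq_norm_sq, hx,
      RCLike.conj_to_real]
    ring
  have hmass : ∀ A : Set E, MeasurableSet A → radialMeasure E A =
      c * ∫⁻ θ, η {p | ‖Ψ (p, θ)‖⁻¹ • Ψ (p, θ) ∈ A ∧ ‖Ψ (p, θ)‖ < 1} ∂τ ∧
      Measurable (fun θ => η {p | ‖Ψ (p, θ)‖⁻¹ • Ψ (p, θ) ∈ A ∧ ‖Ψ (p, θ)‖ < 1}) := by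
    intro A hA
    have hm : MeasurableSet ({v | ‖v‖⁻¹ • v ∈ A} ∩ ball (0 : E) 1) :=
      (measurable_normalize E hA).inter measurableSet_ball
    have hset : ∀ θ, {p | ‖Ψ (p, θ)‖⁻¹ • Ψ (p, θ) ∈ A ∧ ‖Ψ (p, θ)‖ < 1} =
        (fun p => (p, θ)) ⁻¹' (Ψ ⁻¹' ({v | ‖v‖⁻¹ • v ∈ A} ∩ ball (0 : E) 1)) := by
      intro θ
      ext p
      simp
    simp only [hset]
    refine ⟨?_, measurable_measure_prodMk_right (hΨ hm)⟩
    rw [radialMeasure_apply E hA, ← hvol, Measure.smul_apply, Measure.map_apply hΨ hm,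
      Measure.prod_apply_symm (hΨ hm), smul_eq_mul]
  have hJ : ∀ t θ, {p | ‖Ψ (p, θ)‖⁻¹ • Ψ (p, θ) ∈ {y ∈ sphere (0 : E) 1 | t ≤ ⟪y, x⟫} ∧
      ‖Ψ (p, θ)‖ < 1} = J t := by
    intro t θ
    ext p
    have h1 : ‖‖Ψ (p, θ)‖⁻¹ • Ψ (p, θ)‖ = 1 := by
      rw [norm_smul, norm_inv, norm_norm, inv_mul_cancel₀ (hnpos p θ).ne']
    simp only [mem_ofPred_eq, mem_sphere_zero_iff_norm, h1, true_and, inner_smul_left, hinner, J,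
      RCLike.conj_to_real, div_eq_inv_mul]
    rw [hnorm p θ, and_comm]
  have hWJ : ∀ t θ, {p | ‖Ψ (p, θ)‖⁻¹ • Ψ (p, θ) ∈ S ∩ {y ∈ sphere (0 : E) 1 | t ≤ ⟪y, x⟫} ∧
      ‖Ψ (p, θ)‖ < 1} = W θ ∩ J t := by
    intro t θ
    rw [← hJ t θ]
    ext p
    exact and_assoc
  have hnest : ∀ θ, W θ ∩ J t₂ ⊆ J t₁ ∨ J t₁ ⊆ W θ := by
    intro θ
    by_contra! hcon
    obtain ⟨hc1, hc2⟩ := hcon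
    obtain ⟨p, ⟨hpW, hp2⟩, hp1⟩ := not_subset.1 hc1
    obtain ⟨p', hp', hpW'⟩ := not_subset.1 hc2
    have hρ : (0 : ℝ) < p.2 := p.2.2
    have hρ' : (0 : ℝ) < p'.2 := p'.2.2
    have hlt : p.1 / √(p.1 ^ 2 + (p.2 : ℝ) ^ 2) < t₁ := by
      by_contra! hle
      exact hp1 ⟨hp2.1, hle⟩
    have hslope : p.1 * p'.2 ≤ p'.1 * p.2 := by
      by_contra! hle
      exact absurd (div_sqrt_le_div_sqrt hρ hρ' hle.le) (hlt.trans_le hp'.2).not_ge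
    refine hpW' ?_
    have hcomb : Ψ (p', θ) = (p'.1 - p.1 * p'.2 / p.2) • x +
        (p'.2 / p.2 * ‖Ψ (p, θ)‖) • (‖Ψ (p, θ)‖⁻¹ • Ψ (p, θ)) := by
      rw [smul_smul, mul_assoc, mul_inv_cancel₀ (hnpos p θ).ne', mul_one]
      simp only [hΨdef]
      match_scalars <;> field_simp
      ring
    have := hstar _ hpW (p'.1 - p.1 * p'.2 / p.2) (p'.2 / p.2 * ‖Ψ (p, θ)‖)
      (by rw [sub_nonneg, div_le_iff₀ hρ]; exact hslope)
      (mul_pos (div_pos hρ' hρ) (hnpos p θ))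
    rw [← hcomb] at this
    exact this
  have hJmono : J t₁ ⊆ J t₂ := fun p hp => ⟨hp.1, ht.trans hp.2⟩
  have hmeas := (hmass _ (hS.inter (hB t₁))).2
  rw [(hmass _ (hS.inter (hB t₂))).1, (hmass _ (hS.inter (hB t₁))).1, (hmass _ (hB t₂)).1,
    (hmass _ (hB t₁)).1]
  simp only [hJ, hWJ, lintegral_const] at hmeas ⊢
  calc c * (∫⁻ θ, η (W θ ∩ J t₂) ∂τ) * (c * (η (J t₁) * τ univ))
      = c * c * τ univ * ((∫⁻ θ, η (W θ ∩ J t₂) ∂τ) * η (J t₁)) := by ring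
    _ ≤ c * c * τ univ * ((∫⁻ θ, η (W θ ∩ J t₁) ∂τ) * η (J t₂)) := by
        refine mul_le_mul_right ?_ _
        rw [← lintegral_mul_const _ hmeas]
        exact (lintegral_mul_const_le _ _).trans
          (lintegral_mono fun θ => measure_inter_mul_le_of_nested η hJmono (hnest θ))
    _ = _ := by ring

end Polar

section Hausdorff

variable {E : Type*} [NormedAddCommGroup E] [InnerProductSpace ℝ E] [MeasurableSpace E]
  [BorelSpace E]

lemma measurePreserving_hausdorffMeasure_restrict_sphere (d : ℝ) (e : E ≃ₗᵢ[ℝ] E) :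
    MeasurePreserving e ((μH[d] : Measure E).restrict (sphere 0 1))
      ((μH[d] : Measure E).restrict (sphere 0 1)) := by
  have h := (e.toIsometryEquiv.measurePreserving_hausdorffMeasure d).restrict_preimage
    (isClosed_sphere (x := (0 : E)) (ε := 1)).measurableSet
  have hs : e.toIsometryEquiv ⁻¹' sphere (0 : E) 1 = sphere 0 1 := by
    ext v
    simp
  rwa [hs] at h

/-- An isometry-invariant measure on the unit sphere which is finite near one point of the
sphere is locally finite. -/
lemma isLocallyFiniteMeasure_of_isometry_invariant {ν : Measure E}
    (hν : ∀ e : E ≃ₗᵢ[ℝ] E, MeasurePreserving e ν ν) (hνs : ν (sphere 0 1)ᶜ = 0)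
    {x : E} (hx : ‖x‖ = 1) {U : Set E} (hU : U ∈ 𝓝 x) (hfin : ν U ≠ ∞) :
    IsLocallyFiniteMeasure ν := by
  obtain ⟨ε, hε, hεU⟩ := nhds_basis_closedBall.mem_iff.1 hU
  refine ⟨fun y => ?_⟩
  by_cases hy : ‖y‖ = 1
  · refine ⟨closedBall y ε, closedBall_mem_nhds y hε, ?_⟩
    rw [measure_closedBall_eq_of_norm_eq hν (hy.trans hx.symm)]
    exact (measure_mono hεU).trans_lt hfin.lt_top
  · refine ⟨(sphere 0 1)ᶜ, isClosed_sphere.isOpen_compl.mem_nhds (by simpa using hy), ?_⟩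
    rw [hνs]
    exact ENNReal.zero_lt_top

/-- Bishop–Gromov monotonicity for the Hausdorff measure and sets which are star-shaped around
`x` in the sphere. -/
theorem hausdorffMeasure_inter_div_le [FiniteDimensional ℝ E] (d : ℝ)
    (hE : 2 ≤ Module.finrank ℝ E) {x : E} (hx : ‖x‖ = 1)
    {S : Set E} (hS : MeasurableSet S)
    (hstar : ∀ y ∈ S, ∀ a b : ℝ, 0 ≤ a → 0 < b → ‖a • x + b • y‖⁻¹ • (a • x + b • y) ∈ S)
    {t₁ t₂ : ℝ} (ht : t₂ ≤ t₁) (ht₁ : t₁ < 1) :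
    μH[d] (S ∩ {y ∈ sphere 0 1 | t₂ ≤ ⟪y, x⟫}) / μH[d] {y ∈ sphere (0 : E) 1 | t₂ ≤ ⟪y, x⟫} ≤
      μH[d] (S ∩ {y ∈ sphere 0 1 | t₁ ≤ ⟪y, x⟫}) /
        μH[d] {y ∈ sphere (0 : E) 1 | t₁ ≤ ⟪y, x⟫} := by
  have : Nontrivial E := Module.nontrivial_of_finrank_pos (R := ℝ) (by omega)
  set ν : Measure E := (μH[d] : Measure E).restrict (sphere 0 1) with hνdef
  have hsph : MeasurableSet (sphere (0 : E) 1) := isClosed_sphere.measurableSet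
  have hB : ∀ t, μH[d] {y ∈ sphere (0 : E) 1 | t ≤ ⟪y, x⟫} =
      ν {y ∈ sphere (0 : E) 1 | t ≤ ⟪y, x⟫} := fun t =>
    (Measure.restrict_eq_self _ fun y hy => hy.1).symm
  have hSB : ∀ t, μH[d] (S ∩ {y ∈ sphere (0 : E) 1 | t ≤ ⟪y, x⟫}) =
      ν (S ∩ {y ∈ sphere (0 : E) 1 | t ≤ ⟪y, x⟫}) := fun t =>
    (Measure.restrict_eq_self _ fun y hy => hy.2.1).symm
  simp only [hB, hSB]
  by_cases hfin : ν {y ∈ sphere (0 : E) 1 | t₂ ≤ ⟪y, x⟫} = ∞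
  · rw [hfin, ENNReal.div_top]
    exact zero_le
  have hopen : ∀ t, IsOpen {y : E | t < ⟪y, x⟫} := fun t =>
    isOpen_lt (by fun_prop) (by fun_prop)
  have hmem : ∀ t < 1, x ∈ {y : E | t < ⟪y, x⟫} := fun t ht => by
    simpa [hx] using ht
  have hν := measurePreserving_hausdorffMeasure_restrict_sphere (E := E) d
  have hνs : ν (sphere 0 1)ᶜ = 0 := by simp [hνdef, Measure.restrict_apply hsph.compl]
  have hle : ∀ (μ : Measure E), μ (sphere 0 1)ᶜ = 0 → ∀ t,
      μ {y : E | t < ⟪y, x⟫} ≤ μ {y ∈ sphere (0 : E) 1 | t ≤ ⟪y, x⟫} := by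
    intro μ hμ t
    refine measure_mono_ae ?_
    filter_upwards [mem_ae_iff.2 hμ] with y hy hty using ⟨hy, le_of_lt hty⟩
  have : IsLocallyFiniteMeasure ν :=
    isLocallyFiniteMeasure_of_isometry_invariant hν hνs hx
      ((hopen t₂).mem_nhds (hmem t₂ (ht.trans_lt ht₁)))
      ((hle ν hνs t₂).trans_lt (Ne.lt_top hfin)).ne
  have hσs := radialMeasure_compl_sphere E
  have hpos : ∀ t < 1, radialMeasure E {y ∈ sphere (0 : E) 1 | t ≤ ⟪y, x⟫} ≠ 0 := fun t ht =>
    ((radialMeasure_pos E (hopen t) (hmem t ht) hx).trans_le (hle _ hσs t)).ne'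
  have hσ0 : radialMeasure E ≠ 0 := by
    intro h
    exact hpos t₁ ht₁ (by simp [h])
  obtain ⟨c, hc, hνc⟩ := exists_eq_smul_of_isometry_invariant
    (measurePreserving_radialMeasure E) hν hσs hνs hσ0
  have hνc' : ν = c • radialMeasure E := hνc
  simp only [hνc', Measure.smul_apply, smul_eq_mul]
  rcases eq_or_ne c 0 with rfl | hc0
  · simp
  rw [ENNReal.mul_div_mul_left _ _ hc0 hc, ENNReal.mul_div_mul_left _ _ hc0 hc,
    ENNReal.div_le_iff (hpos t₂ (ht.trans_lt ht₁)) (measure_ne_top _ _),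
    ENNReal.mul_comm_div, ← mul_div_assoc, ENNReal.le_div_iff_mul_le
      (Or.inl (hpos t₁ ht₁)) (Or.inl (measure_ne_top _ _))]
  exact radialMeasure_inter_mul_le hE hx hS hstar ht

end Hausdorff

section Gnomonic

variable {n : ℕ}

/-- The point `(x, 1)` of `ℝⁿ × ℝ = ℝ^{n+1}`. -/
noncomputable def affineLift (n : ℕ) (x : EuclideanSpace ℝ (Fin n)) :
    EuclideanSpace ℝ (Fin (n + 1)) :=
  (EuclideanSpace.equiv (Fin (n + 1)) ℝ).symm (Fin.snoc (fun i => x i) 1)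

@[simp] lemma affineLift_last (x : EuclideanSpace ℝ (Fin n)) :
    affineLift n x (Fin.last n) = 1 := by
  simp [affineLift]

@[simp] lemma affineLift_castSucc (x : EuclideanSpace ℝ (Fin n)) (i : Fin n) :
    affineLift n x i.castSucc = x i := by
  simp [affineLift]

lemma norm_affineLift (x : EuclideanSpace ℝ (Fin n)) :
    ‖affineLift n x‖ = √(1 + ‖x‖ ^ 2) := by
  rw [EuclideanSpace.norm_eq, EuclideanSpace.norm_sq_eq, Fin.sum_univ_castSucc, add_comm]
  simp

lemma norm_affineLift_pos (x : EuclideanSpace ℝ (Fin n)) : 0 < ‖affineLift n x‖ := by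
  rw [norm_affineLift]
  positivity

lemma gnomonic_eq_normalize (x : EuclideanSpace ℝ (Fin n)) :
    gnomonic n x = ‖affineLift n x‖⁻¹ • affineLift n x := by
  rw [norm_affineLift]
  rfl

lemma norm_gnomonic (x : EuclideanSpace ℝ (Fin n)) : ‖gnomonic n x‖ = 1 := by
  rw [gnomonic_eq_normalize, norm_smul, norm_inv, norm_norm,
    inv_mul_cancel₀ (norm_affineLift_pos x).ne']

lemma normalize_smul_affineLift {t : ℝ} (ht : 0 < t) (x : EuclideanSpace ℝ (Fin n)) :
    ‖t • affineLift n x‖⁻¹ • (t • affineLift n x) = gnomonic n x := by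
  rw [gnomonic_eq_normalize, norm_smul, Real.norm_of_nonneg ht.le, smul_smul]
  congr 1
  field_simp

lemma continuous_gnomonic : Continuous (gnomonic n) := by
  have h : Continuous (affineLift n) := by
    refine (EuclideanSpace.equiv (Fin (n + 1)) ℝ).symm.continuous.comp (continuous_pi fun i => ?_)
    refine Fin.lastCases ?_ (fun i => ?_) i
    · simpa using continuous_const
    · simp only [Fin.snoc_castSucc]
      fun_prop
  simp only [funext gnomonic_eq_normalize]
  exact (h.norm.inv₀ fun x => (norm_affineLift_pos x).ne').smul h

lemma gnomonic_injective : Function.Injective (gnomonic n) := by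
  intro x y hxy
  rw [gnomonic_eq_normalize, gnomonic_eq_normalize] at hxy
  have hlast := congrArg (fun v => v (Fin.last n)) hxy
  simp only [PiLp.smul_apply, affineLift_last, smul_eq_mul, mul_one] at hlast
  rw [hlast] at hxy
  have hl := smul_right_injective _ (inv_ne_zero (norm_affineLift_pos y).ne') hxy
  ext i
  simpa using congrArg (fun v => v i.castSucc) hl

lemma smul_affineLift_add_smul_affineLift (x y : EuclideanSpace ℝ (Fin n)) {a b : ℝ}
    (hab : a + b ≠ 0) :
    a • affineLift n x + b • affineLift n y =
      (a + b) • affineLift n ((a / (a + b)) • x + (b / (a + b)) • y) := by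
  ext i
  refine Fin.lastCases ?_ (fun i => ?_) i
  · simp
  · simp
    field_simp

/-- The gnomonic image of a convex set is star-shaped around each of its points. -/
lemma normalize_mem_gnomonic_image {K : Set (EuclideanSpace ℝ (Fin n))} (hK : Convex ℝ K)
    {x y : EuclideanSpace ℝ (Fin (n + 1))} (hx : x ∈ gnomonic n '' K) (hy : y ∈ gnomonic n '' K)
    {a b : ℝ} (ha : 0 ≤ a) (hb : 0 < b) :
    ‖a • x + b • y‖⁻¹ • (a • x + b • y) ∈ gnomonic n '' K := by
  obtain ⟨k, hk, rfl⟩ := hx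
  obtain ⟨l, hl, rfl⟩ := hy
  have hα : 0 ≤ a * ‖affineLift n k‖⁻¹ := by positivity
  have hβ : 0 < b * ‖affineLift n l‖⁻¹ := mul_pos hb (inv_pos.2 (norm_affineLift_pos l))
  have hαβ := add_pos_of_nonneg_of_pos hα hβ
  rw [gnomonic_eq_normalize k, gnomonic_eq_normalize l, smul_smul, smul_smul,
    smul_affineLift_add_smul_affineLift _ _ hαβ.ne', normalize_smul_affineLift hαβ]
  refine mem_image_of_mem _ (hK hk hl (by positivity) (by positivity) ?_)
  rw [← add_div, div_self hαβ.ne']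

end Gnomonic

/-- Bishop–Gromov monotonicity for geodesically convex subsets of the open
hemisphere: for the gnomonic image `S` of an open convex set and any `x ∈ S`, the ratio
`μ_n(S ∩ B_S(x,r)) / μ_n(B_S(x,r))` is non-increasing in `r` on `(0, π]`. -/
theorem bishopGromov_convex_hemisphere (n : ℕ) (hn : 1 ≤ n)
    (K₀ : Set (EuclideanSpace ℝ (Fin n))) (hK₀ : Convex ℝ K₀) (hK₀o : IsOpen K₀)
    (x : EuclideanSpace ℝ (Fin (n + 1))) (hx : x ∈ gnomonic n '' K₀)
    (r₁ r₂ : ℝ) (hr₁ : r₁ ∈ Set.Ioc 0 π) (hr₂ : r₂ ∈ Set.Ioc 0 π) (h : r₁ ≤ r₂) :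
    μH[(n : ℝ)] ((gnomonic n '' K₀) ∩ geodesicBall n x r₂) / μH[(n : ℝ)] (geodesicBall n x r₂) ≤
      μH[(n : ℝ)] ((gnomonic n '' K₀) ∩ geodesicBall n x r₁) /
        μH[(n : ℝ)] (geodesicBall n x r₁) := by
  obtain ⟨k, hk, rfl⟩ := hx
  refine hausdorffMeasure_inter_div_le (n : ℝ) (by simpa using hn) (norm_gnomonic k)
    (hK₀o.measurableSet.image_of_continuousOn_injOn continuous_gnomonic.continuousOn
      gnomonic_injective.injOn)
    (fun y hy a b ha hb => normalize_mem_gnomonic_image hK₀ (mem_image_of_mem _ hk) hy ha hb)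
    (Real.cos_le_cos_of_nonneg_of_le_pi hr₁.1.le hr₂.2 h) ?_
  rw [← Real.cos_zero]
  exact Real.cos_lt_cos_of_nonneg_of_le_pi le_rfl hr₁.2 hr₁.1
end

section
/- Volume ratio formula for the double suspension: let X_k be a Borel subset of the closed hemisphere S^k ∩ {y : ⟨y,o⟩ ≥ 0} (in particular, any centrally symmetric geodesically convex subset of S^k containing o), and let X_n = X_k * S^{n-k-1} be its double suspension. Then μ_n(X_n)/μ_n(S^n_+) = μ_k(X_k)/μ_k(S^k_+), where S^k_+ = S^k ∩ {y : ⟨y,o⟩ > 0} is the open hemisphere of S^k centered at o and μ_k denotes k-dimensional Hausdorff measure. -/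
open MeasureTheory Real
open scoped RealInnerProductSpace ENNReal

/-- The subspace `V₁ = ℝᵏ × {0} × ℝ` of `ℝ^{n+1} = ℝᵏ × ℝ^{n-k} × ℝ`, as a set:
coordinates `i` with `i < k` or `i = n` are free, the rest vanish. -/
def V1set (n k : ℕ) : Set (EuclideanSpace ℝ (Fin (n + 1))) :=
  {y | ∀ i : Fin (n + 1), ¬((i : ℕ) < k ∨ (i : ℕ) = n) → y i = 0}

/-- The subspace `V₂ = {0} × ℝ^{n-k} × {0}` of `ℝ^{n+1} = ℝᵏ × ℝ^{n-k} × ℝ`, as a set. -/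
def V2set (n k : ℕ) : Set (EuclideanSpace ℝ (Fin (n + 1))) :=
  {y | ∀ i : Fin (n + 1), ((i : ℕ) < k ∨ (i : ℕ) = n) → y i = 0}

/-- The totally geodesic subsphere `Sᵏ = Sⁿ ∩ V₁` (contains the pole `o`). -/
noncomputable def subSphereK (n k : ℕ) : Set (EuclideanSpace ℝ (Fin (n + 1))) :=
  unitSphereSet n ∩ V1set n k

/-- The complementary totally geodesic subsphere `S^{n-k-1} = Sⁿ ∩ V₂`. -/
noncomputable def subSphereCompl (n k : ℕ) : Set (EuclideanSpace ℝ (Fin (n + 1))) :=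
  unitSphereSet n ∩ V2set n k

/-- Double suspension (spherical join) `X_k * S^{n-k-1}`. -/
noncomputable def doubleSuspension (n k : ℕ) (Xk : Set (EuclideanSpace ℝ (Fin (n + 1)))) :
    Set (EuclideanSpace ℝ (Fin (n + 1))) :=
  {y | ∃ a ∈ Xk, ∃ b ∈ subSphereCompl n k, ∃ t ∈ Set.Icc (0 : ℝ) (π / 2),
    y = Real.cos t • a + Real.sin t • b}

/-- Orthogonal projection onto `V₁`. -/
noncomputable def projV1 (n k : ℕ) (y : EuclideanSpace ℝ (Fin (n + 1))) :
    EuclideanSpace ℝ (Fin (n + 1)) :=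
  (EuclideanSpace.equiv (Fin (n + 1)) ℝ).symm
    fun i => if ((i : ℕ) < k ∨ (i : ℕ) = n) then y i else 0

/-- The tube of width `ε` around the totally geodesic subsphere `Sᵏ = Sⁿ ∩ V₁`:
`T_{V₁}(ε) = {y ∈ Sⁿ : ‖P_{V₁} y‖ ≥ cos ε}`. -/
noncomputable def tubeV1 (n k : ℕ) (ε : ℝ) : Set (EuclideanSpace ℝ (Fin (n + 1))) :=
  {y ∈ unitSphereSet n | Real.cos ε ≤ ‖projV1 n k y‖}

section DoubleSuspension

open Metric Set Filter Topology Module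

section UniformlyDistributed

variable {E : Type*} [NormedAddCommGroup E] [NormedSpace ℝ E] [FiniteDimensional ℝ E]
  [MeasurableSpace E] [BorelSpace E]

/-- A finite measure on a normed space is a constant multiple of another one dominating it, if
both are carried by a set on which closed balls of equal radius have equal measure. -/
lemma exists_eq_smul_of_uniformlyDistributed {S : Set E} {ρ μ : Measure E} [IsFiniteMeasure ρ]
    [IsFiniteMeasure μ] (hac : ρ ≪ μ) (hμS : ∀ᵐ x ∂μ, x ∈ S)
    (hρ : ∀ x ∈ S, ∀ y ∈ S, ∀ r, ρ (closedBall x r) = ρ (closedBall y r))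
    (hμ : ∀ x ∈ S, ∀ y ∈ S, ∀ r, μ (closedBall x r) = μ (closedBall y r)) :
    ∃ c : ℝ≥0∞, ρ = c • μ := by
  have hlim : ∀ᵐ x ∂μ, x ∈ S ∧ Tendsto (fun r => ρ (closedBall x r) / μ (closedBall x r))
      (𝓝[>] 0) (𝓝 (ρ.rnDeriv μ x)) :=
    hμS.and (Besicovitch.ae_tendsto_rnDeriv ρ μ)
  rcases eq_or_ne μ 0 with h0 | h0
  · subst h0
    exact ⟨0, by simpa using hac⟩
  have : NeBot (ae μ) := ae_neBot.2 h0
  obtain ⟨x₀, hx₀, hl₀⟩ := hlim.exists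
  refine ⟨ρ.rnDeriv μ x₀, ?_⟩
  have hconst : ρ.rnDeriv μ =ᵐ[μ] fun _ => ρ.rnDeriv μ x₀ := by
    filter_upwards [hlim] with x hx
    refine tendsto_nhds_unique hx.2 (hl₀.congr fun r => ?_)
    rw [hρ x₀ hx₀ x hx.1, hμ x₀ hx₀ x hx.1]
  rw [← withDensity_const, ← withDensity_congr_ae hconst, Measure.withDensity_rnDeriv_eq _ _ hac]

lemma measure_div_eq_of_uniformlyDistributed {S : Set E} {ρ μ : Measure E} [IsFiniteMeasure ρ]
    [IsFiniteMeasure μ] (hρ0 : ρ ≠ 0) (hμ0 : μ ≠ 0) (hρS : ∀ᵐ x ∂ρ, x ∈ S) (hμS : ∀ᵐ x ∂μ, x ∈ S)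
    (hρ : ∀ x ∈ S, ∀ y ∈ S, ∀ r, ρ (closedBall x r) = ρ (closedBall y r))
    (hμ : ∀ x ∈ S, ∀ y ∈ S, ∀ r, μ (closedBall x r) = μ (closedBall y r)) (A B : Set E) :
    ρ A / ρ B = μ A / μ B := by
  have hS : ∀ᵐ x ∂(ρ + μ), x ∈ S := ae_add_measure_iff.2 ⟨hρS, hμS⟩
  have hadd : ∀ x ∈ S, ∀ y ∈ S, ∀ r, (ρ + μ) (closedBall x r) = (ρ + μ) (closedBall y r) :=
    fun x hx y hy r => by simp [hρ x hx y hy r, hμ x hx y hy r]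
  have key : ∀ ν : Measure E, IsFiniteMeasure ν → ν ≠ 0 → ν ≪ ρ + μ →
      (∀ x ∈ S, ∀ y ∈ S, ∀ r, ν (closedBall x r) = ν (closedBall y r)) →
      ν A / ν B = (ρ + μ) A / (ρ + μ) B := by
    intro ν _ hν0 hac hν
    obtain ⟨c, hc⟩ := exists_eq_smul_of_uniformlyDistributed hac hS hν hadd
    have hc0 : c ≠ 0 := by
      rintro rfl
      exact hν0 (by simpa using hc)
    have hctop : c ≠ ∞ := by
      rintro rfl
      have huniv : ν univ = ∞ * (ρ + μ) univ := by
        conv_lhs => rw [hc]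
        rw [Measure.smul_apply, smul_eq_mul]
      have hne : (ρ + μ) univ ≠ 0 := by
        intro h
        exact hν0 (Measure.measure_univ_eq_zero.1 (hac h))
      rw [ENNReal.top_mul hne] at huniv
      exact measure_ne_top ν univ huniv
    rw [hc]
    simp only [Measure.smul_apply, smul_eq_mul]
    exact ENNReal.mul_div_mul_left _ _ hc0 hctop
  rw [key ρ inferInstance hρ0 (Measure.AbsolutelyContinuous.rfl.add_right μ) hρ,
    key μ inferInstance hμ0 (by rw [add_comm]; exact Measure.AbsolutelyContinuous.rfl.add_right ρ) hμ]

end UniformlyDistributed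

section RadialProjection

variable {E : Type*} [NormedAddCommGroup E] [InnerProductSpace ℝ E] [FiniteDimensional ℝ E]
  (U : Submodule ℝ E)

/-- The radial projection onto the unit sphere of a subspace `U`. -/
noncomputable def radialProj (y : E) : E := ‖U.starProjection y‖⁻¹ • U.starProjection y

variable {U}

lemma radialProj_mem {y : E} (hy : U.starProjection y ≠ 0) :
    radialProj U y ∈ sphere (0 : E) 1 ∩ U := by
  refine ⟨?_, U.smul_mem _ (U.starProjection_apply_mem y)⟩
  simp [radialProj, norm_smul, hy]

lemma starProjection_reflection_orthogonal_singleton {d : E} (hd : d ∈ U) (y : E) :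
    U.starProjection ((ℝ ∙ d)ᗮ.reflection y) = (ℝ ∙ d)ᗮ.reflection (U.starProjection y) := by
  have h : ⟪d, U.starProjection y⟫ = ⟪d, y⟫ := by
    rw [← U.inner_starProjection_left_eq_right, U.starProjection_eq_self_iff.2 hd]
  simp only [Submodule.reflection_orthogonal_apply, Submodule.reflection_singleton_apply, map_neg,
    map_sub, map_nsmul, map_smul, h, U.starProjection_eq_self_iff.2 hd]

lemma radialProj_reflection_orthogonal_singleton {d : E} (hd : d ∈ U) (y : E) :
    radialProj U ((ℝ ∙ d)ᗮ.reflection y) = (ℝ ∙ d)ᗮ.reflection (radialProj U y) := by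
  simp [radialProj, starProjection_reflection_orthogonal_singleton hd]

end RadialProjection

section Sphere

variable {E : Type*} [NormedAddCommGroup E] [InnerProductSpace ℝ E] [FiniteDimensional ℝ E]
  [MeasurableSpace E] [BorelSpace E]

lemma hausdorffMeasure_closedHemisphere_lt_top {d : ℕ} (hd : finrank ℝ E = d + 1) {v : E}
    (hv : ‖v‖ = 1) : μH[(d : ℝ)] {x ∈ sphere (0 : E) 1 | ⟪v, x⟫ ≤ 0} < ∞ := by
  have : Fact (finrank ℝ E = d + 1) := ⟨hd⟩
  have hv0 : v ≠ 0 := by rintro rfl; simp at hv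
  have hW : finrank ℝ (ℝ ∙ v)ᗮ = d := Submodule.finrank_orthogonal_span_singleton hv0
  have hsmooth : ContDiff ℝ 1 (fun w : (ℝ ∙ v)ᗮ => stereoInvFunAux v (w : E)) :=
    contDiff_stereoInvFunAux.comp (ℝ ∙ v)ᗮ.subtypeL.contDiff
  obtain ⟨K, hK⟩ := (hsmooth.contDiffOn (s := closedBall 0 2)).exists_lipschitzOnWith one_ne_zero
    (convex_closedBall _ _) (isCompact_closedBall _ _)
  have hsub : {x ∈ sphere (0 : E) 1 | ⟪v, x⟫ ≤ 0} ⊆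
      (fun w : (ℝ ∙ v)ᗮ => stereoInvFunAux v (w : E)) '' closedBall 0 2 := by
    rintro x ⟨hx, hvx⟩
    have hxv : x ≠ v := by
      rintro rfl
      rw [real_inner_self_eq_norm_sq, hv] at hvx
      norm_num at hvx
    refine ⟨stereoToFun v x, ?_, congrArg Subtype.val (stereo_left_inv hv (x := ⟨x, hx⟩) hxv)⟩
    rw [mem_closedBall_zero_iff, stereoToFun_apply, norm_smul, innerSL_apply_apply]
    have h1 : ‖(ℝ ∙ v)ᗮ.orthogonalProjectionOnto x‖ ≤ 1 :=
      ((ℝ ∙ v)ᗮ.norm_orthogonalProjectionOnto_apply_le x).trans_eq (by simpa using hx)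
    have h2 : ‖(2 : ℝ) / (1 - ⟪v, x⟫)‖ ≤ 2 := by
      rw [Real.norm_of_nonneg (div_nonneg zero_le_two (by linarith))]
      exact div_le_self zero_le_two (by linarith)
    nlinarith [norm_nonneg ((ℝ ∙ v)ᗮ.orthogonalProjectionOnto x)]
  refine (measure_mono hsub).trans_lt ((hK.hausdorffMeasure_image_le d.cast_nonneg).trans_lt ?_)
  refine ENNReal.mul_lt_top (by simp) ?_
  have := (isCompact_closedBall (0 : (ℝ ∙ v)ᗮ) 2).measure_lt_top (μ := μH[finrank ℝ (ℝ ∙ v)ᗮ])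
  rwa [hW] at this

lemma hausdorffMeasure_sphere_lt_top {d : ℕ} (hd : finrank ℝ E = d + 1) :
    μH[(d : ℝ)] (sphere (0 : E) 1) < ∞ := by
  have : Nontrivial E := nontrivial_of_finrank_pos (R := ℝ) (by omega)
  obtain ⟨v, hv⟩ := exists_norm_eq E zero_le_one
  refine (measure_mono ?_).trans_lt (measure_union_lt_top
    (hausdorffMeasure_closedHemisphere_lt_top hd hv)
    (hausdorffMeasure_closedHemisphere_lt_top hd (v := -v) (by simpa)))
  intro x hx
  rcases le_total ⟪v, x⟫ 0 with h | h
  · exact Or.inl ⟨hx, h⟩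
  · exact Or.inr ⟨hx, by simpa using h⟩

lemma hausdorffMeasure_sphere_ne_zero {d : ℕ} (hd : finrank ℝ E = d + 1) :
    μH[(d : ℝ)] (sphere (0 : E) 1) ≠ 0 := by
  have : Fact (finrank ℝ E = d + 1) := ⟨hd⟩
  have : Nontrivial E := nontrivial_of_finrank_pos (R := ℝ) (by omega)
  obtain ⟨v, hv⟩ := exists_norm_eq E zero_le_one
  have hv0 : v ≠ 0 := by rintro rfl; simp at hv
  have hW : finrank ℝ (ℝ ∙ v)ᗮ = d := Submodule.finrank_orthogonal_span_singleton hv0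
  have hsub : ball 0 1 ⊆ (ℝ ∙ v)ᗮ.orthogonalProjectionOnto '' sphere (0 : E) 1 := by
    intro w hw
    have hw1 : ‖(w : E)‖ < 1 := by simpa using hw
    have horth : ⟪(w : E), v⟫ = 0 :=
      Submodule.inner_left_of_mem_orthogonal (Submodule.mem_span_singleton_self v) w.2
    refine ⟨w + √(1 - ‖(w : E)‖ ^ 2) • v, ?_, ?_⟩
    · have h : ‖(w : E) + √(1 - ‖(w : E)‖ ^ 2) • v‖ ^ 2 = 1 := by
        rw [norm_add_sq_real, real_inner_smul_right, horth, norm_smul, hv, Real.norm_eq_abs, mul_one,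
          sq_abs, Real.sq_sqrt (by nlinarith [norm_nonneg (w : E)])]
        ring
      rw [mem_sphere_zero_iff_norm]
      exact (pow_eq_one_iff_of_nonneg (norm_nonneg _) two_ne_zero).1 h
    · rw [map_add, map_smul, Submodule.orthogonalProjectionOnto_mem_subspace_eq_self,
        Submodule.orthogonalProjectionOnto_orthogonalComplement_singleton_eq_zero]
      simp
  have hpos : 0 < μH[(finrank ℝ (ℝ ∙ v)ᗮ : ℝ)] (ball (0 : (ℝ ∙ v)ᗮ) 1) :=
    measure_ball_pos _ _ one_pos
  rw [hW] at hpos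
  exact (hpos.trans_le ((measure_mono hsub).trans
    (hausdorffMeasure_orthogonalProjectionOnto_le _ d _ d.cast_nonneg))).ne'

variable (U : Submodule ℝ E)

lemma hausdorffMeasure_sphere_inter_submodule {F : Type*} [NormedAddCommGroup F]
    [InnerProductSpace ℝ F] [MeasurableSpace F] [BorelSpace F] (V : Submodule ℝ F) (d : ℕ) :
    μH[(d : ℝ)] (sphere (0 : F) 1 ∩ V) = μH[(d : ℝ)] (sphere (0 : V) 1) := by
  rw [← (isometry_subtype_coe (s := (V : Set F))).hausdorffMeasure_image (Or.inl d.cast_nonneg)]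
  congr 1
  ext x
  simp [and_comm]

lemma hausdorffMeasure_submodule_eq_zero {d : ℕ} (hd : finrank ℝ U < d) :
    μH[(d : ℝ)] (U : Set E) = 0 := by
  have h : dimH (U : Set E) = finrank ℝ U := by
    rw [← Real.dimH_univ_eq_finrank, ← (isometry_subtype_coe (s := (U : Set E))).dimH_image]
    simp
  have := hausdorffMeasure_of_dimH_lt (d := d) (s := (U : Set E)) (by rw [h]; exact_mod_cast hd)
  simpa using this

lemma measurable_radialProj : Measurable (radialProj U) := by
  unfold radialProj
  fun_prop

variable {U}

lemma hausdorffMeasure_radialProj_preimage_closedBall (d : ℕ) {x y : E}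
    (hx : x ∈ sphere (0 : E) 1 ∩ U) (hy : y ∈ sphere (0 : E) 1 ∩ U) (r : ℝ) :
    μH[(d : ℝ)] (radialProj U ⁻¹' closedBall x r ∩
        {z ∈ sphere (0 : E) 1 | U.starProjection z ≠ 0}) =
      μH[(d : ℝ)] (radialProj U ⁻¹' closedBall y r ∩
        {z ∈ sphere (0 : E) 1 | U.starProjection z ≠ 0}) := by
  have hxy : ‖x‖ = ‖y‖ := by
    rw [mem_sphere_zero_iff_norm.1 hx.1, mem_sphere_zero_iff_norm.1 hy.1]
  have hd : x - y ∈ U := U.sub_mem hx.2 hy.2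
  set T := (ℝ ∙ (x - y))ᗮ.reflection with hT
  have hTx : T x = y := Submodule.reflection_sub hxy
  rw [← T.toIsometryEquiv.hausdorffMeasure_preimage d (radialProj U ⁻¹' closedBall y r ∩ _)]
  congr 1
  ext z
  have hball : dist (T (radialProj U z)) y = dist (radialProj U z) x := by
    rw [← hTx, T.dist_map]
  simp [hT, radialProj_reflection_orthogonal_singleton hd,
    starProjection_reflection_orthogonal_singleton hd, ← hball]

lemma hausdorffMeasure_sphere_inter_submodule_closedBall (d : ℕ) {x y : E}
    (hx : x ∈ sphere (0 : E) 1 ∩ U) (hy : y ∈ sphere (0 : E) 1 ∩ U) (r : ℝ) :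
    μH[(d : ℝ)] (closedBall x r ∩ (sphere (0 : E) 1 ∩ U)) =
      μH[(d : ℝ)] (closedBall y r ∩ (sphere (0 : E) 1 ∩ U)) := by
  have hxy : ‖x‖ = ‖y‖ := by
    rw [mem_sphere_zero_iff_norm.1 hx.1, mem_sphere_zero_iff_norm.1 hy.1]
  have hd : x - y ∈ U := U.sub_mem hx.2 hy.2
  set T := (ℝ ∙ (x - y))ᗮ.reflection with hT
  have hTx : T x = y := Submodule.reflection_sub hxy
  rw [← T.toIsometryEquiv.hausdorffMeasure_preimage d (closedBall y r ∩ _)]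
  congr 1
  ext z
  have hball : dist (T z) y = dist z x := by
    rw [← hTx, T.dist_map]
  have hU : T z ∈ U ↔ z ∈ U := by
    rw [← U.starProjection_eq_self_iff, ← U.starProjection_eq_self_iff, hT,
      starProjection_reflection_orthogonal_singleton hd, EmbeddingLike.apply_eq_iff_eq]
  change dist z x ≤ r ∧ z ∈ sphere 0 1 ∧ z ∈ U ↔ dist (T z) y ≤ r ∧ T z ∈ sphere 0 1 ∧ T z ∈ U
  simp [hball, hU]

/-- The preimage of a subset of the unit sphere of `U` under the radial projection occupies the
same fraction of Hausdorff measure as the subset itself. -/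
theorem hausdorffMeasure_radialProj_preimage_div {n k : ℕ} (hk : 1 ≤ k) (hE : finrank ℝ E = n + 1)
    (hU : finrank ℝ U = k + 1) {A B : Set E} (hA : MeasurableSet A) (hB : MeasurableSet B)
    (hAU : A ⊆ sphere (0 : E) 1 ∩ U) (hBU : B ⊆ sphere (0 : E) 1 ∩ U) :
    μH[(n : ℝ)] (radialProj U ⁻¹' A ∩ {z ∈ sphere (0 : E) 1 | U.starProjection z ≠ 0}) /
        μH[(n : ℝ)] (radialProj U ⁻¹' B ∩ {z ∈ sphere (0 : E) 1 | U.starProjection z ≠ 0}) =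
      μH[(k : ℝ)] A / μH[(k : ℝ)] B := by
  set S : Set E := sphere (0 : E) 1 ∩ U with hS
  set D : Set E := {z ∈ sphere (0 : E) 1 | U.starProjection z ≠ 0} with hD
  have hq := measurable_radialProj U
  have hSm : MeasurableSet S :=
    (isClosed_sphere.inter U.closed_of_finiteDimensional).measurableSet
  have hDm : MeasurableSet D :=
    isClosed_sphere.measurableSet.inter
      (measurableSet_eq_fun (by fun_prop) measurable_const).compl
  set ρ : Measure E := (μH[(n : ℝ)].restrict D).map (radialProj U) with hρ
  set μ : Measure E := μH[(k : ℝ)].restrict S with hμ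
  have hρ_apply {s : Set E} (hs : MeasurableSet s) :
      ρ s = μH[(n : ℝ)] (radialProj U ⁻¹' s ∩ D) := by
    rw [hρ, Measure.map_apply hq hs, Measure.restrict_apply (hq hs)]
  have hDlt : μH[(n : ℝ)] D < ∞ :=
    (measure_mono (sep_subset _ _)).trans_lt (hausdorffMeasure_sphere_lt_top hE)
  have : Fact (μH[(n : ℝ)] D < ∞) := ⟨hDlt⟩
  have : Fact (μH[(k : ℝ)] S < ∞) := ⟨by
    rw [hausdorffMeasure_sphere_inter_submodule]
    exact hausdorffMeasure_sphere_lt_top hU⟩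
  have hρfin : IsFiniteMeasure ρ := inferInstance
  have hμfin : IsFiniteMeasure μ := inferInstance
  have hμ0 : μ ≠ 0 := by
    rw [hμ, Ne, Measure.restrict_eq_zero, hausdorffMeasure_sphere_inter_submodule]
    exact hausdorffMeasure_sphere_ne_zero hU
  have hρ0 : ρ ≠ 0 := by
    intro h
    have hD0 : μH[(n : ℝ)] D = 0 := by
      simpa [h] using (hρ_apply MeasurableSet.univ).symm
    have hperp : μH[(n : ℝ)] (Uᗮ : Set E) = 0 := by
      apply hausdorffMeasure_submodule_eq_zero
      have := U.finrank_add_finrank_orthogonal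
      omega
    refine hausdorffMeasure_sphere_ne_zero hE (measure_mono_null (fun x hx => ?_)
      (measure_union_null hD0 hperp))
    by_cases hx0 : U.starProjection x = 0
    · exact Or.inr (U.starProjection_apply_eq_zero_iff.1 hx0)
    · exact Or.inl ⟨hx, hx0⟩
  have hρS : ∀ᵐ x ∂ρ, x ∈ S := by
    refine (ae_map_iff hq.aemeasurable hSm).2 ?_
    exact (ae_restrict_mem hDm).mono fun x hx => radialProj_mem hx.2
  have main := measure_div_eq_of_uniformlyDistributed hρ0 hμ0 hρS (ae_restrict_mem hSm)
    (fun x hx y hy r => by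
      rw [hρ_apply measurableSet_closedBall, hρ_apply measurableSet_closedBall]
      exact hausdorffMeasure_radialProj_preimage_closedBall n hx hy r)
    (fun x hx y hy r => by
      rw [hμ, Measure.restrict_apply measurableSet_closedBall,
        Measure.restrict_apply measurableSet_closedBall]
      exact hausdorffMeasure_sphere_inter_submodule_closedBall k hx hy r) A B
  rwa [hρ_apply hA, hρ_apply hB, hμ, Measure.restrict_apply hA, Measure.restrict_apply hB,
    inter_eq_self_of_subset_left hAU, inter_eq_self_of_subset_left hBU] at main

end Sphere

section Coordinates

variable {n k : ℕ}

/-- `V1set n k` as a submodule. -/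
def V1submodule (n k : ℕ) : Submodule ℝ (EuclideanSpace ℝ (Fin (n + 1))) where
  carrier := V1set n k
  add_mem' hx hy i hi := by simp [hx i hi, hy i hi]
  zero_mem' i _ := by simp
  smul_mem' c x hx i hi := by simp [hx i hi]

lemma mem_V1submodule_orthogonal {y : EuclideanSpace ℝ (Fin (n + 1))} :
    y ∈ (V1submodule n k)ᗮ ↔ y ∈ V2set n k := by
  rw [Submodule.mem_orthogonal]
  refine ⟨fun h i hi => ?_, fun h u hu => ?_⟩
  · have hmem : EuclideanSpace.single i (1 : ℝ) ∈ V1submodule n k := by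
      intro j hj
      have hji : j ≠ i := by rintro rfl; exact hj hi
      simp [hji]
    simpa [EuclideanSpace.inner_single_left] using h _ hmem
  · rw [PiLp.inner_apply]
    refine Finset.sum_eq_zero fun i _ => ?_
    by_cases hi : (i : ℕ) < k ∨ (i : ℕ) = n
    · simp [h i hi]
    · simp [hu i hi]

lemma card_V1_coordinates (hkn : k ≤ n) :
    Fintype.card {i : Fin (n + 1) // (i : ℕ) < k ∨ (i : ℕ) = n} = k + 1 := by
  rw [Fintype.card_subtype]
  have h : (Finset.univ.filter fun i : Fin (n + 1) => (i : ℕ) < k ∨ (i : ℕ) = n).map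
      Fin.valEmbedding = insert n (Finset.range k) := by
    ext j
    simp only [Finset.mem_map, Finset.mem_filter, Finset.mem_univ, true_and, Fin.valEmbedding_apply,
      Finset.mem_insert, Finset.mem_range]
    constructor
    · rintro ⟨i, hi, rfl⟩
      exact hi.symm
    · intro hj
      exact ⟨⟨j, by omega⟩, hj.symm, rfl⟩
  rw [← Finset.card_map, h, Finset.card_insert_of_notMem (by simpa using hkn), Finset.card_range]

lemma finrank_V1submodule (hkn : k ≤ n) : finrank ℝ (V1submodule n k) = k + 1 := by
  let e : V1submodule n k ≃ₗ[ℝ] ({i : Fin (n + 1) // (i : ℕ) < k ∨ (i : ℕ) = n} → ℝ) :=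
    { toFun := fun x i => x.1 i.1
      map_add' := fun x y => rfl
      map_smul' := fun c x => rfl
      invFun := fun f => ⟨WithLp.toLp 2 fun i =>
        if h : (i : ℕ) < k ∨ (i : ℕ) = n then f ⟨i, h⟩ else 0, fun i hi => by simp [hi]⟩
      left_inv := fun x => by
        ext i
        by_cases hi : (i : ℕ) < k ∨ (i : ℕ) = n
        · simp [hi]
        · simp [hi, x.2 i hi]
      right_inv := fun f => by
        ext i
        simp [i.2] }
  rw [e.finrank_eq, finrank_fintype_fun_eq_card, card_V1_coordinates hkn]

lemma subSphereCompl_nonempty (hkn : k < n) : (subSphereCompl n k).Nonempty := by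
  refine ⟨EuclideanSpace.single ⟨k, by omega⟩ 1, by simp [unitSphereSet], fun i hi => ?_⟩
  have : i ≠ ⟨k, by omega⟩ := by
    rintro rfl
    simp at hi
    omega
  simp [this]

lemma mem_doubleSuspension_iff (hkn : k < n) {Xk : Set (EuclideanSpace ℝ (Fin (n + 1)))}
    (hXk : Xk ⊆ subSphereK n k) {y : EuclideanSpace ℝ (Fin (n + 1))}
    (hy : (V1submodule n k).starProjection y ≠ 0) :
    y ∈ doubleSuspension n k Xk ↔ radialProj (V1submodule n k) y ∈ Xk ∧ y ∈ unitSphereSet n := by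
  set U := V1submodule n k
  constructor
  · rintro ⟨a, ha, b, hb, t, ht, rfl⟩
    have ha1 : ‖a‖ = 1 := mem_sphere_zero_iff_norm.1 (hXk ha).1
    have hb1 : ‖b‖ = 1 := mem_sphere_zero_iff_norm.1 hb.1
    have haU : a ∈ U := (hXk ha).2
    have hbU : b ∈ Uᗮ := mem_V1submodule_orthogonal.2 hb.2
    have hP : U.starProjection (cos t • a + sin t • b) = cos t • a := by
      rw [map_add, map_smul, map_smul, U.starProjection_eq_self_iff.2 haU,
        U.starProjection_apply_eq_zero_iff.2 hbU, smul_zero, add_zero]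
    rw [hP] at hy
    have hcos : 0 < cos t :=
      (cos_nonneg_of_mem_Icc ⟨by linarith [ht.1, pi_pos], ht.2⟩).lt_of_ne'
        (by rintro h; simp [h] at hy)
    constructor
    · rw [radialProj, hP, norm_smul, ha1, mul_one, Real.norm_of_nonneg hcos.le,
        inv_smul_smul₀ hcos.ne']
      exact ha
    · have hab : ⟪a, b⟫ = 0 := U.inner_right_of_mem_orthogonal haU hbU
      have h : ‖cos t • a + sin t • b‖ ^ 2 = 1 := by
        rw [norm_add_sq_real, norm_smul, norm_smul, ha1, hb1, inner_smul_left, inner_smul_right, hab]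
        simp
      rw [unitSphereSet, mem_sphere_zero_iff_norm]
      exact (pow_eq_one_iff_of_nonneg (norm_nonneg _) two_ne_zero).1 h
  · rintro ⟨hq, hy1⟩
    have hy1 : ‖y‖ = 1 := mem_sphere_zero_iff_norm.1 hy1
    set p := U.starProjection y with hp
    set w := Uᗮ.starProjection y with hw
    have hpw : p + w = y := U.starProjection_add_starProjection_orthogonal y
    have hsq : ‖p‖ ^ 2 + ‖w‖ ^ 2 = 1 := by
      rw [← Submodule.norm_sq_eq_add_norm_sq_starProjection, hy1, one_pow]
    obtain ⟨b, hb, hbw⟩ : ∃ b ∈ subSphereCompl n k, ‖w‖ • b = w := by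
      rcases eq_or_ne w 0 with h0 | h0
      · obtain ⟨b, hb⟩ := subSphereCompl_nonempty hkn
        exact ⟨b, hb, by simp [h0]⟩
      · refine ⟨‖w‖⁻¹ • w, ⟨?_, ?_⟩, smul_inv_smul₀ (norm_ne_zero_iff.2 h0) w⟩
        · simp [unitSphereSet, norm_smul, h0]
        · exact mem_V1submodule_orthogonal.1 (Uᗮ.smul_mem _ (Uᗮ.starProjection_apply_mem y))
    have hp1 : ‖p‖ ≤ 1 := by nlinarith [norm_nonneg p, sq_nonneg ‖w‖]
    refine ⟨_, hq, b, hb, arccos ‖p‖, ⟨arccos_nonneg _, arccos_le_pi_div_two.2 (norm_nonneg _)⟩, ?_⟩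
    rw [cos_arccos (by linarith [norm_nonneg p]) hp1, sin_arccos, radialProj, ← hp,
      smul_inv_smul₀ (norm_ne_zero_iff.2 hy), ← hsq, add_sub_cancel_left,
      Real.sqrt_sq (norm_nonneg _), hbw, hpw]

lemma hemisphere_eq (n k : ℕ) : hemisphere n =
    radialProj (V1submodule n k) ⁻¹' (subSphereK n k ∩ {y | 0 < ⟪y, pole n⟫}) ∩
      {z ∈ sphere (0 : EuclideanSpace ℝ (Fin (n + 1))) 1 |
        (V1submodule n k).starProjection z ≠ 0} := by
  set U := V1submodule n k
  have hpole : pole n ∈ U := by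
    intro i hi
    have : i ≠ Fin.last n := by
      rintro rfl
      simp at hi
    simp [pole, this]
  have hinner (y) : ⟪U.starProjection y, pole n⟫ = ⟪y, pole n⟫ := by
    rw [U.inner_starProjection_left_eq_right, U.starProjection_eq_self_iff.2 hpole]
  have hpos {y} (hy : U.starProjection y ≠ 0) :
      0 < ⟪radialProj U y, pole n⟫ ↔ 0 < ⟪y, pole n⟫ := by
    rw [radialProj, real_inner_smul_left, hinner]
    exact mul_pos_iff_of_pos_left (inv_pos.2 (norm_pos_iff.2 hy))
  ext y
  constructor
  · rintro ⟨hy1, hy⟩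
    have hy0 : U.starProjection y ≠ 0 := by
      intro h
      rw [← hinner, h, inner_zero_left] at hy
      exact hy.false
    exact ⟨⟨radialProj_mem hy0, (hpos hy0).2 hy⟩, hy1, hy0⟩
  · rintro ⟨⟨-, hy⟩, hy1, hy0⟩
    exact ⟨hy1, (hpos hy0).1 hy⟩

lemma hausdorffMeasure_doubleSuspension (hk : 1 ≤ k) (hkn : k < n)
    {Xk : Set (EuclideanSpace ℝ (Fin (n + 1)))}
    (hXk : Xk ⊆ subSphereK n k) : μH[(n : ℝ)] (doubleSuspension n k Xk) =
      μH[(n : ℝ)] (radialProj (V1submodule n k) ⁻¹' Xk ∩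
        {z ∈ sphere (0 : EuclideanSpace ℝ (Fin (n + 1))) 1 |
          (V1submodule n k).starProjection z ≠ 0}) := by
  have hperp : μH[(n : ℝ)] ((V1submodule n k)ᗮ : Set (EuclideanSpace ℝ (Fin (n + 1)))) = 0 := by
    apply hausdorffMeasure_submodule_eq_zero
    have := (V1submodule n k).finrank_add_finrank_orthogonal
    rw [finrank_V1submodule hkn.le, finrank_euclideanSpace_fin] at this
    omega
  refine measure_congr ?_
  filter_upwards [measure_eq_zero_iff_ae_notMem.1 hperp] with y hy
  have hy0 : (V1submodule n k).starProjection y ≠ 0 := fun h =>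
    hy ((V1submodule n k).starProjection_apply_eq_zero_iff.1 h)
  refine propext ((mem_doubleSuspension_iff hkn hXk hy0).trans ?_)
  exact and_congr_right fun _ => ⟨fun h => ⟨h, hy0⟩, fun h => h.1⟩

end Coordinates

end DoubleSuspension

/-- Volume ratio formula for the double suspension:
`μ_n(X_n)/μ_n(Sⁿ₊) = μ_k(X_k)/μ_k(Sᵏ₊)`. -/
theorem doubleSuspension_volume_ratio (n k : ℕ) (hk : 1 ≤ k) (hkn : k ≤ n - 1) (hn : 1 ≤ n)
    (Xk : Set (EuclideanSpace ℝ (Fin (n + 1)))) (hXkm : MeasurableSet Xk)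
    (hXk : Xk ⊆ subSphereK n k ∩ {y | 0 ≤ ⟪y, pole n⟫}) :
    μH[(n : ℝ)] (doubleSuspension n k Xk) / μH[(n : ℝ)] (hemisphere n) =
      μH[(k : ℝ)] Xk / μH[(k : ℝ)] (subSphereK n k ∩ {y | 0 < ⟪y, pole n⟫}) := by
  have hkn' : k < n := by omega
  have hXS : Xk ⊆ subSphereK n k := fun x hx => (hXk hx).1
  have hS : MeasurableSet (subSphereK n k) :=
    (Metric.isClosed_sphere.inter (V1submodule n k).closed_of_finiteDimensional).measurableSet
  have hB : MeasurableSet (subSphereK n k ∩ {y | 0 < ⟪y, pole n⟫}) :=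
    hS.inter (measurableSet_lt measurable_const (by fun_prop))
  rw [hausdorffMeasure_doubleSuspension hk hkn' hXS, hemisphere_eq n k]
  exact hausdorffMeasure_radialProj_preimage_div hk finrank_euclideanSpace_fin
    (finrank_V1submodule hkn'.le) hXkm hB hXS Set.inter_subset_left
end

section
/- High dimensions imply all dimensions for the Cauchy correlation inequality: suppose there exists an integer N such that for every n ≥ N and all symmetric convex sets K, M ⊆ ℝ^n one has ν_n(K ∩ M) ≥ ν_n(K)·ν_n(M). Then for every n ≥ 1 and all symmetric convex sets K, M ⊆ ℝ^n, ν_n(K ∩ M) ≥ ν_n(K)·ν_n(M). -/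
open MeasureTheory Real
open scoped RealInnerProductSpace ENNReal

namespace CauchyCorrelation

theorem integrable_cauchyDensity (n : ℕ) : Integrable (cauchyDensity n) := by
  have := integrable_rpow_neg_one_add_norm_sq (E := EuclideanSpace ℝ (Fin n)) (μ := volume)
    (r := (n : ℝ) + 1) (by simp)
  simp only [neg_div] at this
  exact this

theorem cauchyDensity_pos (n : ℕ) (x : EuclideanSpace ℝ (Fin n)) : 0 < cauchyDensity n x := by
  unfold cauchyDensity
  positivity

theorem integral_cauchyDensity_pos (n : ℕ) :
    0 < ∫ x : EuclideanSpace ℝ (Fin n), cauchyDensity n x := by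
  rw [integral_pos_iff_support_of_nonneg (fun x => (cauchyDensity_pos n x).le)
    (integrable_cauchyDensity n)]
  have : Function.support (cauchyDensity n) = Set.univ :=
    Set.eq_univ_of_forall fun x => (cauchyDensity_pos n x).ne'
  rw [this]
  exact Measure.measure_univ_pos.2 (NeZero.ne _)

/-- The Cauchy measure before normalization. -/
noncomputable def unnormalizedCauchy (n : ℕ) : Measure (EuclideanSpace ℝ (Fin n)) :=
  volume.withDensity fun x => ENNReal.ofReal (cauchyDensity n x)

theorem unnormalizedCauchy_univ (n : ℕ) : unnormalizedCauchy n Set.univ =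
    ENNReal.ofReal (∫ x : EuclideanSpace ℝ (Fin n), cauchyDensity n x) := by
  rw [unnormalizedCauchy, withDensity_apply _ MeasurableSet.univ, Measure.restrict_univ,
    ofReal_integral_eq_lintegral_ofReal (integrable_cauchyDensity n)
      (ae_of_all _ fun x => (cauchyDensity_pos n x).le)]

theorem unnormalizedCauchy_univ_ne_zero (n : ℕ) : unnormalizedCauchy n Set.univ ≠ 0 := by
  rw [unnormalizedCauchy_univ]
  exact (ENNReal.ofReal_pos.2 (integral_cauchyDensity_pos n)).ne'

theorem unnormalizedCauchy_univ_ne_top (n : ℕ) : unnormalizedCauchy n Set.univ ≠ ∞ := by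
  rw [unnormalizedCauchy_univ]
  exact ENNReal.ofReal_ne_top

theorem cauchyMeasure_eq_smul (n : ℕ) :
    cauchyMeasure n = (unnormalizedCauchy n Set.univ)⁻¹ • unnormalizedCauchy n := by
  rw [unnormalizedCauchy_univ, unnormalizedCauchy, ← withDensity_smul']
  · unfold cauchyMeasure cauchyConst
    congr 1
    ext x
    rw [ENNReal.ofReal_mul (inv_nonneg.2 (integral_cauchyDensity_pos n).le),
      ENNReal.ofReal_inv_of_pos (integral_cauchyDensity_pos n)]
    rfl
  · exact ENNReal.inv_ne_top.2 (ENNReal.ofReal_pos.2 (integral_cauchyDensity_pos n)).ne'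

/-- The projection `ℝⁿ⁺¹ → ℝⁿ` forgetting the first coordinate. -/
noncomputable def tail (n : ℕ) : EuclideanSpace ℝ (Fin (n + 1)) →ₗ[ℝ] EuclideanSpace ℝ (Fin n) where
  toFun x := WithLp.toLp 2 fun i => x i.succ
  map_add' x y := by ext i; simp
  map_smul' c x := by ext i; simp

theorem norm_sq_eq_add_tail (n : ℕ) (x : EuclideanSpace ℝ (Fin (n + 1))) :
    ‖x‖ ^ 2 = x 0 ^ 2 + ‖tail n x‖ ^ 2 := by
  simp [EuclideanSpace.real_norm_sq_eq, Fin.sum_univ_succ, tail]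

theorem measurable_tail (n : ℕ) : Measurable (tail n) :=
  (LinearMap.continuous_of_finiteDimensional _).measurable

theorem measurePreserving_head_tail (n : ℕ) :
    MeasurePreserving (fun x : EuclideanSpace ℝ (Fin (n + 1)) => (x 0, tail n x)) := by
  have h := ((MeasurePreserving.id (volume : Measure ℝ)).prod
    (PiLp.volume_preserving_toLp (Fin n))).comp
    ((volume_preserving_piFinSuccAbove (fun _ : Fin (n + 1) => ℝ) 0).comp
      (PiLp.volume_preserving_ofLp (Fin (n + 1))))
  exact h

theorem lintegral_rpow_scale (p r : ℝ) :
    ∫⁻ t : ℝ, ENNReal.ofReal ((1 + (t ^ 2 + r ^ 2)) ^ (-((p + 1) / 2))) =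
      (∫⁻ t : ℝ, ENNReal.ofReal ((1 + t ^ 2) ^ (-((p + 1) / 2)))) *
        ENNReal.ofReal ((1 + r ^ 2) ^ (-(p / 2))) := by
  have hb : 0 < 1 + r ^ 2 := by positivity
  have ha : 0 < √(1 + r ^ 2) := Real.sqrt_pos.2 hb
  have hsq : √(1 + r ^ 2) ^ 2 = 1 + r ^ 2 := Real.sq_sqrt hb.le
  have hm (q : ℝ) : Measurable fun t : ℝ =>
      ENNReal.ofReal ((1 + (t ^ 2 + r ^ 2)) ^ q) := by fun_prop
  conv_lhs => rw [← Real.smul_map_volume_mul_left ha.ne']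
  rw [lintegral_smul_measure, lintegral_map (hm _) (measurable_const_mul _),
    smul_eq_mul, ← lintegral_const_mul' _ _ ENNReal.ofReal_ne_top,
    ← lintegral_mul_const' _ _ ENNReal.ofReal_ne_top]
  congr 1
  ext t
  rw [← ENNReal.ofReal_mul (abs_nonneg _), ← ENNReal.ofReal_mul (by positivity)]
  congr 1
  have e : 1 + ((√(1 + r ^ 2) * t) ^ 2 + r ^ 2) = (1 + t ^ 2) * (1 + r ^ 2) := by
    rw [mul_pow, hsq]; ring
  rw [e, Real.mul_rpow (by positivity) hb.le, abs_of_pos ha, Real.sqrt_eq_rpow, mul_left_comm,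
    ← Real.rpow_add hb]
  congr 2
  ring

theorem map_tail_unnormalizedCauchy (n : ℕ) : (unnormalizedCauchy (n + 1)).map (tail n) =
    (∫⁻ t : ℝ, ENNReal.ofReal ((1 + t ^ 2) ^ (-(((n : ℝ) + 1 + 1) / 2)))) •
      unnormalizedCauchy n := by
  ext S hS
  set F : ℝ × EuclideanSpace ℝ (Fin n) → ℝ≥0∞ := (Prod.snd ⁻¹' S).indicator fun z =>
    ENNReal.ofReal ((1 + (z.1 ^ 2 + ‖z.2‖ ^ 2)) ^ (-(((n : ℝ) + 1 + 1) / 2))) with hF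
  have hFm : Measurable F :=
    Measurable.indicator (by fun_prop) (measurable_snd hS)
  rw [Measure.map_apply (measurable_tail n) hS, unnormalizedCauchy,
    withDensity_apply _ (measurable_tail n hS), ← lintegral_indicator (measurable_tail n hS)]
  have h₁ : (tail n ⁻¹' S).indicator (fun x => ENNReal.ofReal (cauchyDensity (n + 1) x)) =
      fun x => F (x 0, tail n x) := by
    ext x
    simp only [hF, Set.indicator, Set.mem_preimage, cauchyDensity, norm_sq_eq_add_tail]
    push_cast
    rfl
  rw [h₁, (measurePreserving_head_tail n).lintegral_comp hFm, Measure.volume_eq_prod,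
    lintegral_prod_symm' _ hFm, Measure.smul_apply, smul_eq_mul, unnormalizedCauchy,
    withDensity_apply _ hS, ← lintegral_indicator hS, ← lintegral_const_mul]
  · congr 1
    ext y
    by_cases hy : y ∈ S
    · simpa [hF, Set.indicator, hy, cauchyDensity] using lintegral_rpow_scale ((n : ℝ) + 1) ‖y‖
    · simp [hF, Set.indicator, hy]
  · exact Measurable.indicator (by unfold cauchyDensity; fun_prop) hS

theorem map_tail_cauchyMeasure (n : ℕ) :
    (cauchyMeasure (n + 1)).map (tail n) = cauchyMeasure n := by
  have h := map_tail_unnormalizedCauchy n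
  set c := ∫⁻ t : ℝ, ENNReal.ofReal ((1 + t ^ 2) ^ (-(((n : ℝ) + 1 + 1) / 2)))
  have hu : unnormalizedCauchy (n + 1) Set.univ = c * unnormalizedCauchy n Set.univ := by
    have := congrArg (fun μ => μ Set.univ) h
    simpa [Measure.map_apply (measurable_tail n) MeasurableSet.univ] using this
  have hc₀ : c ≠ 0 := fun h₀ => unnormalizedCauchy_univ_ne_zero (n + 1) (by simp [hu, h₀])
  have hc : c ≠ ∞ := fun h₀ => unnormalizedCauchy_univ_ne_top (n + 1) (by
    rw [hu, h₀, ENNReal.top_mul (unnormalizedCauchy_univ_ne_zero n)])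
  rw [cauchyMeasure_eq_smul, cauchyMeasure_eq_smul, Measure.map_smul, h, hu, smul_smul,
    ENNReal.mul_inv (.inl hc₀) (.inl hc), mul_right_comm, ENNReal.inv_mul_cancel hc₀ hc, one_mul]

theorem cauchyMeasure_preimage_tail (n : ℕ) {K : Set (EuclideanSpace ℝ (Fin n))}
    (hK : Convex ℝ K) : cauchyMeasure (n + 1) (tail n ⁻¹' K) = cauchyMeasure n K := by
  have hm : NullMeasurableSet K (cauchyMeasure n) :=
    (hK.nullMeasurableSet volume).mono_ac (withDensity_absolutelyContinuous _ _)
  rw [← map_tail_cauchyMeasure] at hm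
  rw [← Measure.map_apply₀ (measurable_tail n).aemeasurable hm, map_tail_cauchyMeasure]

/-- The correlation inequality for symmetric convex sets in dimension `n`. -/
def CorrelationInequality (n : ℕ) : Prop :=
  ∀ K M : Set (EuclideanSpace ℝ (Fin n)),
    Convex ℝ K → K = -K → Convex ℝ M → M = -M →
    cauchyMeasure n (K ∩ M) ≥ cauchyMeasure n K * cauchyMeasure n M

theorem CorrelationInequality.of_succ {n : ℕ} (h : CorrelationInequality (n + 1)) :
    CorrelationInequality n := by
  have hneg (K : Set (EuclideanSpace ℝ (Fin n))) (hK : K = -K) :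
      tail n ⁻¹' K = -(tail n ⁻¹' K) := by
    ext x
    rw [Set.mem_neg, Set.mem_preimage, Set.mem_preimage, map_neg, ← Set.mem_neg, ← hK]
  intro K M hK hK' hM hM'
  have := h _ _ (hK.linear_preimage (tail n)) (hneg K hK') (hM.linear_preimage (tail n))
    (hneg M hM')
  rwa [← Set.preimage_inter, cauchyMeasure_preimage_tail n hK, cauchyMeasure_preimage_tail n hM,
    cauchyMeasure_preimage_tail n (hK.inter hM)] at this

end CauchyCorrelation

/-- High dimensions imply all dimensions for the Cauchy correlation
inequality. -/
theorem cauchy_correlation_high_dim_implies_all (N : ℕ)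
    (h : ∀ n : ℕ, N ≤ n → ∀ K M : Set (EuclideanSpace ℝ (Fin n)),
      Convex ℝ K → K = -K → Convex ℝ M → M = -M →
      cauchyMeasure n (K ∩ M) ≥ cauchyMeasure n K * cauchyMeasure n M) :
    ∀ n : ℕ, 1 ≤ n → ∀ K M : Set (EuclideanSpace ℝ (Fin n)),
      Convex ℝ K → K = -K → Convex ℝ M → M = -M →
      cauchyMeasure n (K ∩ M) ≥ cauchyMeasure n K * cauchyMeasure n M := by
  intro n _
  change CauchyCorrelation.CorrelationInequality n
  rcases le_total N n with hn | hn
  · exact h n hn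
  · exact Nat.decreasingInduction (motive := fun k _ => CauchyCorrelation.CorrelationInequality k)
      (fun _ _ hk => hk.of_succ) (h N le_rfl) hn
end

section
/- Concentration for sin^{n-1}-concave densities on an interval (one-dimensional case of the Gromov–Memarian lemma): let n ≥ 2 and let f : I → [0,∞) be an integrable sin^{n-1}-concave function on an interval I ⊆ (-π/2, π/2) with 0 ∈ I, such that ∫_I f > 0 and f attains its maximum at 0. Then for every ε ∈ (0, π/2]: (∫_{I ∩ [-ε,ε]} f(t) dt) / (∫_I f(t) dt) ≥ (∫₀^ε cos^{n-1}(t) dt) / (∫₀^{π/2} cos^{n-1}(t) dt). -/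
open Real MeasureTheory

/-- `f` is `sinᵏ`-concave on the interval `I` (of length less than `π`). -/
def SinPowConcaveOn (k : ℕ) (I : Set ℝ) (f : ℝ → ℝ) : Prop :=
  ∀ x₁ ∈ I, ∀ x₂ ∈ I, x₁ ≠ x₂ → ∀ α ∈ Set.Ioo (0 : ℝ) 1,
    f (α * x₁ + (1 - α) * x₂) ^ ((1 : ℝ) / k) ≥
      (Real.sin (α * |x₂ - x₁|) * f x₁ ^ ((1 : ℝ) / k) +
          Real.sin ((1 - α) * |x₂ - x₁|) * f x₂ ^ ((1 : ℝ) / k)) /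
        Real.sin |x₂ - x₁|

/-- Reflecting a `sinᵏ`-concave function through the origin keeps it `sinᵏ`-concave. -/
theorem SinPowConcaveOn.comp_neg {k : ℕ} {I : Set ℝ} {f : ℝ → ℝ} (h : SinPowConcaveOn k I f) :
    SinPowConcaveOn k (Neg.neg ⁻¹' I) fun x => f (-x) := by
  intro x₁ h₁ x₂ h₂ hne α hα
  have key := h (-x₁) h₁ (-x₂) h₂ (fun e => hne (neg_injective e)) α hα
  have e₁ : |(-x₂) - (-x₁)| = |x₂ - x₁| := by
    rw [abs_sub_comm]
    congr 1
    ring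
  have e₂ : α * -x₁ + (1 - α) * -x₂ = -(α * x₁ + (1 - α) * x₂) := by ring
  rwa [e₁, e₂] at key

/-- Three-point form of `sinᵏ`-concavity between `0` and `t`. -/
theorem SinPowConcaveOn.sin_mul_add_le {k : ℕ} {I : Set ℝ} {f : ℝ → ℝ}
    (h : SinPowConcaveOn k I f) (h0 : (0 : ℝ) ∈ I) {s t : ℝ} (hs : 0 < s) (hst : s < t)
    (ht : t ∈ I) (htpi : t < π) :
    sin s * f t ^ ((1 : ℝ) / k) + sin (t - s) * f 0 ^ ((1 : ℝ) / k) ≤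
      f s ^ ((1 : ℝ) / k) * sin t := by
  have ht0 : 0 < t := hs.trans hst
  have key := h t ht 0 h0 ht0.ne' (s / t) ⟨div_pos hs ht0, (div_lt_one ht0).2 hst⟩
  have e₁ : s / t * t = s := div_mul_cancel₀ s ht0.ne'
  have e₂ : (1 - s / t) * t = t - s := by rw [sub_mul, e₁, one_mul]
  rw [zero_sub, abs_neg, abs_of_pos ht0, mul_zero, add_zero, e₁, e₂, ge_iff_le,
    div_le_iff₀ (sin_pos_of_pos_of_lt_pi ht0 htpi)] at key
  exact key

/-- If a `sinᵏ`-concave function is maximal at `0`, then `f / cosᵏ` is nonincreasing to the right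
of `0`. -/
theorem SinPowConcaveOn.mul_cos_pow_le {k : ℕ} (hk : k ≠ 0) {I : Set ℝ} {f : ℝ → ℝ}
    (h : SinPowConcaveOn k I f) (hI : I.OrdConnected) (hIsub : I ⊆ Set.Ioo (-(π / 2)) (π / 2))
    (h0 : (0 : ℝ) ∈ I) (hf : ∀ x ∈ I, 0 ≤ f x) (hmax : ∀ x ∈ I, f x ≤ f 0)
    {s t : ℝ} (hs : 0 ≤ s) (hst : s ≤ t) (ht : t ∈ I) :
    f t * cos s ^ k ≤ f s * cos t ^ k := by
  rcases hst.eq_or_lt with rfl | hst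
  · rfl
  have ht0 : 0 < t := hs.trans_lt hst
  have htpi : t < π / 2 := (hIsub ht).2
  have htpi' : t < π := by linarith [pi_pos]
  set g : ℝ → ℝ := fun x => f x ^ ((1 : ℝ) / k) with hg
  have hmem : ∀ r, 0 ≤ r → r ≤ t → r ∈ I := fun r h₁ h₂ => hI.out h0 ht ⟨h₁, h₂⟩
  have hgnn : ∀ x ∈ I, 0 ≤ g x := fun x hx => rpow_nonneg (hf x hx) _
  have hgpow : ∀ x ∈ I, g x ^ k = f x := fun x hx => by
    simp only [hg, one_div]
    exact rpow_inv_natCast_pow (hf x hx) hk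
  have hcost : 0 < cos t := cos_pos_of_mem_Ioo (hIsub ht)
  have hsint : 0 < sin t := sin_pos_of_pos_of_lt_pi ht0 htpi'
  have hle : g t ≤ g 0 * cos t := by
    have half : ∀ r ∈ Set.Ioo 0 t, g t * cos (r / 2) ≤ g 0 * cos (t - r / 2) := by
      intro r hr
      have key := h.sin_mul_add_le h0 hr.1 hr.2 ht htpi'
      have hrI := hmem r hr.1.le hr.2.le
      have hgr : g r ≤ g 0 := rpow_le_rpow (hf r hrI) (hmax r hrI) (by positivity)
      have hsin : 0 < sin (r / 2) :=
        sin_pos_of_pos_of_lt_pi (by linarith [hr.1]) (by linarith [hr.2])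
      change sin r * g t + sin (t - r) * g 0 ≤ g r * sin t at key
      have e₁ : sin r = 2 * sin (r / 2) * cos (r / 2) := by rw [← sin_two_mul]; ring_nf
      have e₂ : sin t - sin (t - r) = 2 * sin (r / 2) * cos (t - r / 2) := by
        rw [sin_sub_sin]
        ring_nf
      have hmul := mul_le_mul_of_nonneg_right hgr hsint.le
      refine le_of_mul_le_mul_left ?_ (mul_pos two_pos hsin)
      calc 2 * sin (r / 2) * (g t * cos (r / 2)) = sin r * g t := by rw [e₁]; ring
        _ ≤ g 0 * (sin t - sin (t - r)) := by linarith
        _ = _ := by rw [e₂]; ring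
    have hcl : closure (Set.Ioo 0 t) = Set.Icc 0 t := closure_Ioo ht0.ne
    have hlim := closure_minimal (s := Set.Ioo 0 t)
      (t := {r | g t * cos (r / 2) ≤ g 0 * cos (t - r / 2)}) half
      (isClosed_le (by fun_prop) (by fun_prop))
    have h00 := hlim (hcl ▸ Set.left_mem_Icc.2 ht0.le)
    simpa using h00
  have hmono : g t * cos s ≤ g s * cos t := by
    rcases hs.eq_or_lt with rfl | hs
    · simpa using hle
    have key := h.sin_mul_add_le h0 hs hst ht htpi'
    change sin s * g t + sin (t - s) * g 0 ≤ g s * sin t at key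
    have hsin : 0 ≤ sin (t - s) := sin_nonneg_of_nonneg_of_le_pi (by linarith) (by linarith)
    have h₁ := mul_le_mul_of_nonneg_left hle hsin
    have h₂ := mul_le_mul_of_nonneg_right key hcost.le
    refine le_of_mul_le_mul_left ?_ hsint
    calc sin t * (g t * cos s) = sin (t - s) * g t + sin s * g t * cos t := by
          rw [sin_sub]; ring
      _ ≤ sin t * (g s * cos t) := by linarith
  have hsI := hmem s hs hst.le
  have hcoss : 0 ≤ cos s := (cos_pos_of_mem_Ioo (hIsub hsI)).le
  have := pow_le_pow_left₀ (mul_nonneg (hgnn t ht) hcoss) hmono k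
  rwa [mul_pow, mul_pow, hgpow t ht, hgpow s hsI] at this

/-- Chebyshev-type comparison: if `F / cosᵏ` is nonincreasing on `[0, π/2)`, then `F` puts
relatively more mass on `[0, ε]` than `cosᵏ` does. -/
theorem integral_cos_pow_mul_integral_le {k : ℕ} {F : ℝ → ℝ} (hF : Integrable F)
    (hmono : ∀ s t, 0 ≤ s → s ≤ t → t < π / 2 → F t * cos s ^ k ≤ F s * cos t ^ k)
    {ε : ℝ} (hε : ε ∈ Set.Ioc 0 (π / 2)) :
    (∫ t in (0 : ℝ)..ε, cos t ^ k) * ∫ t in ε..(π / 2), F t ≤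
      (∫ t in ε..(π / 2), cos t ^ k) * ∫ t in (0 : ℝ)..ε, F t := by
  rcases hε.2.eq_or_lt with rfl | hlt
  · simp
  have hcosε : 0 < cos ε ^ k := pow_pos (cos_pos_of_mem_Ioo ⟨by linarith [hε.1, pi_pos], hlt⟩) k
  have hci : ∀ a b : ℝ, IntervalIntegrable (fun t => cos t ^ k) volume a b := fun a b =>
    Continuous.intervalIntegrable (by fun_prop) a b
  have hnn : ∀ a b : ℝ, 0 ≤ a → a ≤ b → b ≤ π / 2 → 0 ≤ ∫ t in a..b, cos t ^ k := by
    intro a b ha hab hb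
    refine intervalIntegral.integral_nonneg hab fun t ht => pow_nonneg ?_ k
    exact cos_nonneg_of_mem_Icc ⟨by linarith [ht.1, pi_pos], by linarith [ht.2]⟩
  set K := F ε / cos ε ^ k
  have hP : K * (∫ t in (0 : ℝ)..ε, cos t ^ k) ≤ ∫ t in (0 : ℝ)..ε, F t := by
    rw [← intervalIntegral.integral_const_mul]
    refine intervalIntegral.integral_mono_on hε.1.le ((hci _ _).const_mul K)
      hF.intervalIntegrable fun t ht => ?_
    rw [div_mul_eq_mul_div, div_le_iff₀ hcosε]
    exact hmono t ε ht.1 ht.2 hlt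
  have hQ : (∫ t in ε..(π / 2), F t) ≤ K * ∫ t in ε..(π / 2), cos t ^ k := by
    rw [← intervalIntegral.integral_const_mul]
    refine intervalIntegral.integral_mono_on_of_le_Ioo hε.2 hF.intervalIntegrable
      ((hci _ _).const_mul K) fun t ht => ?_
    rw [div_mul_eq_mul_div, le_div_iff₀ hcosε]
    exact hmono ε t hε.1.le ht.1.le ht.2
  calc _ ≤ (∫ t in (0 : ℝ)..ε, cos t ^ k) * (K * ∫ t in ε..(π / 2), cos t ^ k) :=
        mul_le_mul_of_nonneg_left hQ (hnn 0 ε le_rfl hε.1.le hε.2)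
    _ = (∫ t in ε..(π / 2), cos t ^ k) * (K * ∫ t in (0 : ℝ)..ε, cos t ^ k) := by ring
    _ ≤ _ := mul_le_mul_of_nonneg_left hP (hnn ε _ hε.1.le hε.2 le_rfl)

/-- One-sided concentration for a `sinᵏ`-concave function extended by zero. -/
theorem SinPowConcaveOn.integral_cos_pow_mul_integral_indicator_le {k : ℕ} (hk : k ≠ 0)
    {I : Set ℝ} {f : ℝ → ℝ} (h : SinPowConcaveOn k I f) (hI : I.OrdConnected)
    (hIsub : I ⊆ Set.Ioo (-(π / 2)) (π / 2))
    (h0 : (0 : ℝ) ∈ I) (hf : ∀ x ∈ I, 0 ≤ f x) (hmax : ∀ x ∈ I, f x ≤ f 0)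
    (hint : Integrable (I.indicator f)) {ε : ℝ} (hε : ε ∈ Set.Ioc 0 (π / 2)) :
    (∫ t in (0 : ℝ)..ε, cos t ^ k) * ∫ t in ε..(π / 2), I.indicator f t ≤
      (∫ t in ε..(π / 2), cos t ^ k) * ∫ t in (0 : ℝ)..ε, I.indicator f t := by
  refine integral_cos_pow_mul_integral_le hint (fun s t hs hst ht => ?_) hε
  by_cases hm : t ∈ I
  · rw [Set.indicator_of_mem hm, Set.indicator_of_mem (hI.out h0 hm ⟨hs, hst⟩)]
    exact h.mul_cos_pow_le hk hI hIsub h0 hf hmax hs hst hm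
  · rw [Set.indicator_of_notMem hm, zero_mul]
    exact mul_nonneg (Set.indicator_nonneg hf s)
      (pow_nonneg (cos_nonneg_of_mem_Icc ⟨by linarith [pi_pos], ht.le⟩) k)

/-- Concentration for `sin^{n-1}`-concave densities on an interval
(one-dimensional Gromov–Memarian lemma): if `f` is `sin^{n-1}`-concave on
`I ⊆ (-π/2, π/2)`, integrable with positive integral, and attains its maximum at `0`,
then the mass of `[-ε, ε]` is at least the corresponding ratio for `cos^{n-1}`. -/
theorem sinPowConcave_concentration (n : ℕ) (hn : 2 ≤ n) (I : Set ℝ)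
    (hI : Set.OrdConnected I) (hIsub : I ⊆ Set.Ioo (-(π / 2)) (π / 2)) (h0I : (0 : ℝ) ∈ I)
    (f : ℝ → ℝ) (hf : ∀ x ∈ I, 0 ≤ f x) (hint : IntegrableOn f I)
    (hpos : 0 < ∫ t in I, f t) (hmax : ∀ x ∈ I, f x ≤ f 0)
    (hconc : SinPowConcaveOn (n - 1) I f)
    (ε : ℝ) (hε : ε ∈ Set.Ioc 0 (π / 2)) :
    (∫ t in I ∩ Set.Icc (-ε) ε, f t) / ∫ t in I, f t ≥
      (∫ t in (0 : ℝ)..ε, Real.cos t ^ (n - 1)) /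
        ∫ t in (0 : ℝ)..(π / 2), Real.cos t ^ (n - 1) := by
  have hk : n - 1 ≠ 0 := by omega
  have hIm : MeasurableSet I := hI.measurableSet
  have hF : Integrable (I.indicator f) := hint.integrable_indicator hIm
  have hii : ∀ a b : ℝ, IntervalIntegrable (I.indicator f) volume a b := fun _ _ =>
    hF.intervalIntegrable
  have hci : ∀ a b : ℝ, IntervalIntegrable (fun t => cos t ^ (n - 1)) volume a b := fun a b =>
    Continuous.intervalIntegrable (by fun_prop) a b
  have hright := hconc.integral_cos_pow_mul_integral_indicator_le hk hI hIsub h0I hf hmax hF hε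
  have hindicator : (Neg.neg ⁻¹' I).indicator (fun x => f (-x)) = fun x => I.indicator f (-x) := rfl
  have hleft := hconc.comp_neg.integral_cos_pow_mul_integral_indicator_le hk
    (hI.preimage_anti fun _ _ hab => neg_le_neg hab)
    (fun x hx => ⟨by linarith [(hIsub hx).2], by linarith [(hIsub hx).1]⟩)
    (by simpa using h0I) (fun x hx => hf _ hx) (fun x hx => by simpa using hmax _ hx)
    (hindicator ▸ hF.comp_neg) hε
  simp only [hindicator, intervalIntegral.integral_comp_neg (I.indicator f), neg_zero] at hleft
  have hnum : ∫ t in I ∩ Set.Icc (-ε) ε, f t =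
      (∫ t in (-ε)..0, I.indicator f t) + ∫ t in (0 : ℝ)..ε, I.indicator f t := by
    rw [intervalIntegral.integral_add_adjacent_intervals (hii _ _) (hii _ _),
      intervalIntegral.integral_of_le (by linarith [hε.1]), ← integral_Icc_eq_integral_Ioc,
      setIntegral_indicator hIm, Set.inter_comm]
  have hden : ∫ t in I, f t =
      ((∫ t in (-(π / 2))..(-ε), I.indicator f t) + ∫ t in (-ε)..0, I.indicator f t) +
        ((∫ t in (0 : ℝ)..ε, I.indicator f t) + ∫ t in ε..(π / 2), I.indicator f t) := by
    rw [intervalIntegral.integral_add_adjacent_intervals (hii _ _) (hii _ _),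
      intervalIntegral.integral_add_adjacent_intervals (hii _ _) (hii _ _),
      intervalIntegral.integral_add_adjacent_intervals (hii _ _) (hii _ _),
      intervalIntegral.integral_of_le (by linarith [pi_pos]), setIntegral_indicator hIm,
      Set.inter_eq_right.2 (hIsub.trans Set.Ioo_subset_Ioc_self)]
  have hcos : 0 < ∫ t in (0 : ℝ)..(π / 2), cos t ^ (n - 1) :=
    intervalIntegral.intervalIntegral_pos_of_pos_on (hci _ _)
      (fun t ht => pow_pos (cos_pos_of_mem_Ioo ⟨by linarith [ht.1, pi_pos], ht.2⟩) _)
      (by positivity)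
  have hsplit := intervalIntegral.integral_add_adjacent_intervals (hci 0 ε) (hci ε (π / 2))
  rw [ge_iff_le, div_le_div_iff₀ hcos hpos, hnum, hden, ← hsplit]
  linarith
end
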